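/- arXiv:1105.3040 — 3 statements merged into one kernel-verified Lean document; each statement's English description precedes it below -/
import Mathlib

section
/- Let G : [0,∞) → (compact subsets of E) be bounded on compact time intervals with closed Borel graph. Then for every u⁰ ∈ 𝔘 there exists a Carathéodory function w⁰ : [0,∞)×ℝ^k → [0,∞) such that: (i) w⁰(t,u⁰(t)) = 0 for a.e. t; (ii) if u ∈ 𝔘 and τ ≥ 0 satisfy 𝓛_{w⁰}[u](τ) = 0, then u = u⁰ a.e. on [0,τ]; and (iii) for every u ∈ 𝔘, every ξ ∈ E and every T ≥ 0, if the solution y of ẏ = a(t,y,u(t)), y(0) = ξ satisfies y(t) ∈ G(t) for all t ∈ [0,T], then ‖κ(τ, y(τ)) − ξ‖ ≤ 𝓛_{w⁰}[u](τ) for all τ ∈ [0,T]. -/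
open MeasureTheory Set intervalIntegral

/-- Composing a function that is absolutely continuous and nonpositive on an interval with `exp`
gives an absolutely continuous function. -/
lemma AbsolutelyContinuousOnInterval.exp_of_nonpos {f : ℝ → ℝ} {a b : ℝ}
    (hf : AbsolutelyContinuousOnInterval f a b) (h0 : ∀ x ∈ uIcc a b, f x ≤ 0) :
    AbsolutelyContinuousOnInterval (fun x => Real.exp (f x)) a b := by
  have hlip : ∀ x ≤ (0 : ℝ), ∀ y ≤ (0 : ℝ), dist (Real.exp x) (Real.exp y) ≤ dist x y := by
    intro x hx y hy
    have h := (convex_Iic (0 : ℝ)).norm_image_sub_le_of_norm_deriv_le (f := Real.exp) (C := 1)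
      (fun z _ => Real.differentiableAt_exp)
      (fun z hz => by simpa [abs_of_pos (Real.exp_pos z)] using hz) hy hx
    simpa [Real.dist_eq] using h
  rw [absolutelyContinuousOnInterval_iff] at hf ⊢
  intro ε hε
  obtain ⟨δ, hδ, H⟩ := hf ε hε
  refine ⟨δ, hδ, fun I hI hlen => lt_of_le_of_lt (Finset.sum_le_sum fun i hi => ?_) (H I hI hlen)⟩
  exact hlip _ (h0 _ (hI.1 i hi).1) _ (h0 _ (hI.1 i hi).2)

/-- **Grönwall's inequality**, integral form, backward in time, with an integrable coefficient. -/
lemma gronwall_backward {s t c : ℝ} {L g : ℝ → ℝ} (hst : s ≤ t)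
    (hL : IntervalIntegrable L volume s t) (hL0 : ∀ r, 0 ≤ L r)
    (hg : ContinuousOn g (Icc s t))
    (h : ∀ r ∈ Icc s t, g r ≤ c + ∫ x in r..t, L x * g x) :
    g s ≤ c * Real.exp (∫ x in s..t, L x) := by
  have hu : uIcc s t = Icc s t := uIcc_of_le hst
  have hLg : IntervalIntegrable (fun x => L x * g x) volume s t :=
    hL.mul_continuousOn (hu ▸ hg)
  set F : ℝ → ℝ := fun r => c - ∫ x in t..r, L x * g x with hF
  set φ : ℝ → ℝ := fun r => Real.exp (∫ x in t..r, L x) with hφ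
  have hFac : AbsolutelyContinuousOnInterval F s t := by
    have h1 : AbsolutelyContinuousOnInterval (fun _ : ℝ => c) s t :=
      (contDiff_const (𝕜 := ℝ) (n := 1)).contDiffOn.absolutelyContinuousOnInterval
    exact h1.sub (hLg.absolutelyContinuousOnInterval_intervalIntegral (c := t) right_mem_uIcc)
  have hφac : AbsolutelyContinuousOnInterval φ s t := by
    refine (hL.absolutelyContinuousOnInterval_intervalIntegral
      (c := t) right_mem_uIcc).exp_of_nonpos ?_
    intro x hx
    rw [hu] at hx
    rw [intervalIntegral.integral_symm, neg_nonpos]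
    exact intervalIntegral.integral_nonneg hx.2 fun r _ => hL0 r
  have key := hFac.integral_deriv_mul_eq_sub hφac
  have hnn : 0 ≤ ∫ x in s..t, deriv F x * φ x + F x * deriv φ x := by
    refine intervalIntegral.integral_nonneg_of_ae_restrict hst ?_
    rw [Filter.EventuallyLE, ae_restrict_iff' measurableSet_Icc]
    filter_upwards [hL.ae_hasDerivAt_integral, hLg.ae_hasDerivAt_integral] with x h1 h2 hx
    rw [← hu] at hx
    have d1 := (h1 hx t right_mem_uIcc).exp
    have d2 := (h2 hx t right_mem_uIcc).const_sub c
    rw [hF, hφ, d1.deriv, d2.deriv]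
    rw [hu] at hx
    have h3 := h x hx
    rw [intervalIntegral.integral_symm, ← sub_eq_add_neg] at h3
    have h4 := mul_nonneg (mul_nonneg (hL0 x) (Real.exp_pos (∫ y in t..x, L y)).le)
      (sub_nonneg.2 h3)
    simp only [Pi.zero_apply]
    linarith
  rw [key] at hnn
  have h1 : F t * φ t = c := by simp [hF, hφ]
  have h2 : φ s * Real.exp (∫ x in s..t, L x) = 1 := by
    rw [hφ, ← Real.exp_add, intervalIntegral.integral_symm, neg_add_cancel, Real.exp_zero]
  have h3 : g s ≤ F s := by
    have := h s (left_mem_Icc.2 hst)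
    rw [intervalIntegral.integral_symm, ← sub_eq_add_neg] at this
    exact this
  calc g s ≤ F s := h3
    _ = F s * φ s * Real.exp (∫ x in s..t, L x) := by rw [mul_assoc, h2, mul_one]
    _ ≤ c * Real.exp (∫ x in s..t, L x) := by
        gcongr
        linarith

/-- Backward stability estimate for two primitives whose derivatives differ by at most
`L ‖z - x‖ + d`. -/
lemma norm_sub_le_of_backward_integral {E : Type*} [NormedAddCommGroup E] [NormedSpace ℝ E]
    {s t : ℝ} {z x p q : ℝ → E} {L d : ℝ → ℝ} (hst : s ≤ t)
    (hz : ContinuousOn z (Icc s t)) (hx : ContinuousOn x (Icc s t))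
    (hp : IntervalIntegrable p volume s t) (hq : IntervalIntegrable q volume s t)
    (hzp : ∀ r ∈ Icc s t, z t = z r + ∫ v in r..t, p v)
    (hxq : ∀ r ∈ Icc s t, x t = x r + ∫ v in r..t, q v)
    (hL : IntervalIntegrable L volume s t) (hL0 : ∀ r, 0 ≤ L r)
    (hd : IntervalIntegrable d volume s t) (hd0 : ∀ r, 0 ≤ d r)
    (h : ∀ᵐ r ∂volume.restrict (Icc s t), ‖p r - q r‖ ≤ L r * ‖z r - x r‖ + d r) :
    ‖z s - x s‖ ≤ (‖z t - x t‖ + ∫ r in s..t, d r) * Real.exp (∫ r in s..t, L r) := by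
  have hg : ContinuousOn (fun r => ‖z r - x r‖) (Icc s t) := (hz.sub hx).norm
  refine gronwall_backward (g := fun r => ‖z r - x r‖) hst hL hL0 hg fun r hr => ?_
  have hsub : uIcc r t ⊆ uIcc s t := by
    rw [uIcc_of_le hst, uIcc_of_le hr.2]
    exact Icc_subset_Icc_left hr.1
  have hLg : IntervalIntegrable (fun r => L r * ‖z r - x r‖) volume s t :=
    hL.mul_continuousOn (uIcc_of_le hst ▸ hg)
  have e : z r - x r = (z t - x t) - ∫ v in r..t, (p v - q v) := by
    rw [intervalIntegral.integral_sub (hp.mono_set hsub) (hq.mono_set hsub), hzp r hr, hxq r hr]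
    abel
  have h1 : ‖∫ v in r..t, (p v - q v)‖ ≤ ∫ v in r..t, (L v * ‖z v - x v‖ + d v) := by
    refine intervalIntegral.norm_integral_le_of_norm_le hr.2 ?_
      ((hLg.add hd).mono_set hsub)
    rw [ae_restrict_iff' measurableSet_Icc] at h
    filter_upwards [h] with v hv hv'
    exact hv ⟨hr.1.trans hv'.1.le, hv'.2⟩
  rw [intervalIntegral.integral_add (hLg.mono_set hsub) (hd.mono_set hsub)] at h1
  have h2 : ∫ v in r..t, d v ≤ ∫ v in s..t, d v :=
    intervalIntegral.integral_mono_interval hr.1 hr.2 le_rfl (Filter.Eventually.of_forall hd0) hd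
  have h3 := norm_sub_le (z t - x t) (∫ v in r..t, (p v - q v))
  rw [← e] at h3
  linarith

/-- `x` is a Carathéodory solution on `[0,∞)` of `ẋ = f(t,x)`. -/
structure IsCaratheodorySolution {E : Type*} [NormedAddCommGroup E] [NormedSpace ℝ E]
    (f : ℝ → E → E) (x : ℝ → E) : Prop where
  continuousOn : ContinuousOn x (Ici 0)
  intervalIntegrable : ∀ s ≥ (0 : ℝ), ∀ t ≥ (0 : ℝ),
    IntervalIntegrable (fun r => f r (x r)) volume s t
  eq_add_integral : ∀ s ≥ (0 : ℝ), ∀ t ≥ (0 : ℝ), x t = x s + ∫ r in s..t, f r (x r)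

/-- Two solutions of `ẋ = f(t,x)` and `ẏ = g(t,y)` staying in the ball of radius `R`, in which `f`
is Lipschitz. -/
lemma IsCaratheodorySolution.norm_sub_le {E : Type*} [NormedAddCommGroup E] [NormedSpace ℝ E]
    {f g : ℝ → E → E} {z x : ℝ → E} {L d : ℝ → ℝ} {R s t : ℝ}
    (hz : IsCaratheodorySolution f z) (hx : IsCaratheodorySolution g x)
    (hs : 0 ≤ s) (hst : s ≤ t)
    (hzR : ∀ r ∈ Ioo s t, ‖z r‖ ≤ R) (hxR : ∀ r ∈ Ioo s t, ‖x r‖ ≤ R)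
    (hL : IntervalIntegrable L volume s t) (hL0 : ∀ r, 0 ≤ L r)
    (hLip : ∀ᵐ r ∂volume.restrict (Ici (0 : ℝ)), ∀ y₁ y₂ : E, ‖y₁‖ ≤ R → ‖y₂‖ ≤ R →
      ‖f r y₁ - f r y₂‖ ≤ L r * ‖y₁ - y₂‖)
    (hd : IntervalIntegrable d volume s t) (hd0 : ∀ r, 0 ≤ d r)
    (hfg : ∀ r ∈ Ioo s t, ‖f r (x r) - g r (x r)‖ ≤ d r) :
    ‖z s - x s‖ ≤ (‖z t - x t‖ + ∫ r in s..t, d r) * Real.exp (∫ r in s..t, L r) := by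
  have hsub : Icc s t ⊆ Ici 0 := fun r hr => hs.trans hr.1
  refine norm_sub_le_of_backward_integral hst (hz.continuousOn.mono hsub)
    (hx.continuousOn.mono hsub)
    (hz.intervalIntegrable s hs t (hs.trans hst)) (hx.intervalIntegrable s hs t (hs.trans hst))
    (fun r hr => hz.eq_add_integral r (hsub hr) t (hs.trans hst))
    (fun r hr => hx.eq_add_integral r (hsub hr) t (hs.trans hst)) hL hL0 hd hd0 ?_
  rw [← restrict_Ioo_eq_restrict_Icc, ae_restrict_iff' measurableSet_Ioo]
  rw [ae_restrict_iff' measurableSet_Ici] at hLip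
  filter_upwards [hLip] with r hr hrst
  have h1 := hr (hs.trans hrst.1.le) (z r) (x r) (hzR r hrst) (hxR r hrst)
  calc ‖f r (z r) - g r (x r)‖ = ‖(f r (z r) - f r (x r)) + (f r (x r) - g r (x r))‖ := by
        congr 1; abel
    _ ≤ _ := (norm_add_le _ _).trans (add_le_add h1 (hfg r hrst))

/-- A solution of `ẋ = f(t,x)` that is close enough to `z` at time `t` remains within distance
`1` of it on `[0,t]`. -/
lemma IsCaratheodorySolution.norm_sub_lt_one {E : Type*} [NormedAddCommGroup E] [NormedSpace ℝ E]
    {f : ℝ → E → E} {z x : ℝ → E} {L : ℝ → ℝ} {M t : ℝ}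
    (hz : IsCaratheodorySolution f z) (hx : IsCaratheodorySolution f x)
    (hzM : ∀ r ∈ Icc 0 t, ‖z r‖ ≤ M)
    (hL : IntervalIntegrable L volume 0 t) (hL0 : ∀ r, 0 ≤ L r)
    (hLip : ∀ᵐ r ∂volume.restrict (Ici (0 : ℝ)), ∀ y₁ y₂ : E, ‖y₁‖ ≤ M + 1 → ‖y₂‖ ≤ M + 1 →
      ‖f r y₁ - f r y₂‖ ≤ L r * ‖y₁ - y₂‖)
    (hclose : ‖z t - x t‖ * Real.exp (∫ r in (0 : ℝ)..t, L r) < 1) :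
    ∀ s ∈ Icc 0 t, ‖z s - x s‖ < 1 := by
  by_contra! hcon
  obtain ⟨s₀, hs₀, hs₀'⟩ := hcon
  have hsub : Icc 0 t ⊆ Ici (0 : ℝ) := fun r hr => hr.1
  have hg : ContinuousOn (fun r => ‖z r - x r‖) (Icc 0 t) :=
    ((hz.continuousOn.mono hsub).sub (hx.continuousOn.mono hsub)).norm
  set S : Set ℝ := Icc 0 t ∩ (fun r => ‖z r - x r‖) ⁻¹' Ici 1 with hS
  have hSc : IsCompact S :=
    isCompact_Icc.of_isClosed_subset (hg.preimage_isClosed_of_isClosed isClosed_Icc isClosed_Ici)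
      inter_subset_left
  obtain ⟨s, ⟨hs, hs1⟩, hmax⟩ := hSc.exists_isGreatest ⟨s₀, hs₀, hs₀'⟩
  have hlt : ∀ r ∈ Ioo s t, ‖z r - x r‖ < 1 := by
    intro r hr
    by_contra! hge
    exact absurd (hmax ⟨⟨hs.1.trans hr.1.le, hr.2.le⟩, hge⟩) (not_le.2 hr.1)
  have hsubI : uIcc s t ⊆ uIcc 0 t := by
    rw [uIcc_of_le hs.2, uIcc_of_le (hs.1.trans hs.2)]
    exact Icc_subset_Icc_left hs.1
  have hzR : ∀ r ∈ Ioo s t, ‖z r‖ ≤ M := fun r hr => hzM r ⟨hs.1.trans hr.1.le, hr.2.le⟩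
  have h1 := hz.norm_sub_le (d := fun _ => 0) hx hs.1 hs.2 (R := M + 1)
    (fun r hr => (hzR r hr).trans (by linarith))
    (fun r hr => by
      have h2 := norm_sub_norm_le (x r) (z r)
      rw [norm_sub_rev] at h2
      have := hlt r hr
      have := hzR r hr
      linarith)
    (hL.mono_set hsubI) hL0 hLip intervalIntegrable_const (fun _ => le_rfl) (by simp)
  have h2 : ∫ r in s..t, L r ≤ ∫ r in (0 : ℝ)..t, L r :=
    intervalIntegral.integral_mono_interval hs.1 hs.2 le_rfl (Filter.Eventually.of_forall hL0) hL
  have h3 : ‖z t - x t‖ * Real.exp (∫ r in s..t, L r)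
      ≤ ‖z t - x t‖ * Real.exp (∫ r in (0 : ℝ)..t, L r) := by gcongr
  have h4 : (1 : ℝ) ≤ ‖z s - x s‖ := hs1
  simp only [intervalIntegral.integral_zero, add_zero] at h1
  linarith

/-- Solutions passing through a bounded set during `[0,T]` are uniformly bounded backward in
time. -/
lemma exists_bound_backward_solutions {E : Type*} [NormedAddCommGroup E] [NormedSpace ℝ E]
    [ProperSpace E] {f : ℝ → E → E}
    (hLip : ∀ R : ℝ, ∃ L : ℝ → ℝ, (∀ t, 0 ≤ L t) ∧ (∀ T : ℝ, IntegrableOn L (Icc 0 T)) ∧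
      ∀ᵐ r ∂volume.restrict (Ici (0 : ℝ)), ∀ y₁ y₂ : E, ‖y₁‖ ≤ R → ‖y₂‖ ≤ R →
        ‖f r y₁ - f r y₂‖ ≤ L r * ‖y₁ - y₂‖)
    (hex : ∀ t ≥ (0 : ℝ), ∀ y : E, ∃ x, IsCaratheodorySolution f x ∧ x t = y) (T ρ : ℝ) :
    ∃ R, ∀ t ∈ Icc 0 T, ∀ x, IsCaratheodorySolution f x → ‖x t‖ ≤ ρ →
      ∀ s ∈ Icc 0 t, ‖x s‖ ≤ R := by
  have hK : IsCompact (Icc 0 T ×ˢ Metric.closedBall (0 : E) ρ) :=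
    isCompact_Icc.prod (isCompact_closedBall _ _)
  have main : ∃ R, ∀ p ∈ Icc 0 T ×ˢ Metric.closedBall (0 : E) ρ, ∀ x,
      IsCaratheodorySolution f x → x p.1 = p.2 → ∀ s ∈ Icc 0 p.1, ‖x s‖ ≤ R := by
    refine hK.induction_on (p := fun A => ∃ R, ∀ p ∈ A, ∀ x,
      IsCaratheodorySolution f x → x p.1 = p.2 → ∀ s ∈ Icc 0 p.1, ‖x s‖ ≤ R) ?_ ?_ ?_ ?_
    · exact ⟨0, by simp⟩
    · rintro A B hAB ⟨R, hR⟩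
      exact ⟨R, fun p hp => hR p (hAB hp)⟩
    · rintro A B ⟨R, hR⟩ ⟨R', hR'⟩
      refine ⟨max R R', fun p hp x hx hxp s hs => ?_⟩
      rcases hp with hp | hp
      · exact (hR p hp x hx hxp s hs).trans (le_max_left _ _)
      · exact (hR' p hp x hx hxp s hs).trans (le_max_right _ _)
    · rintro ⟨t₀, y₀⟩ ⟨ht₀, hy₀⟩
      obtain ⟨z, hz, hzt⟩ := hex t₀ ht₀.1 y₀
      have hsub : Icc 0 T ⊆ Ici (0 : ℝ) := fun r hr => hr.1
      obtain ⟨M, hM⟩ := isCompact_Icc.exists_bound_of_continuousOn (hz.continuousOn.mono hsub)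
      obtain ⟨L, hL0, hLi, hLL⟩ := hLip (M + 1)
      set Λ := Real.exp (∫ r in (0 : ℝ)..T, L r)
      have hcont : ContinuousOn (fun p : ℝ × E => ‖z p.1 - p.2‖ * Λ)
          (Icc 0 T ×ˢ Metric.closedBall (0 : E) ρ) :=
        ((((hz.continuousOn.mono hsub).comp continuousOn_fst fun p hp => hp.1).sub
          continuousOn_snd).norm).mul continuousOn_const
      have hev := (hcont (t₀, y₀) ⟨ht₀, hy₀⟩).eventually
        (p := fun v => v < 1) (gt_mem_nhds (by simp [hzt]))
      refine ⟨_, Filter.inter_mem hev self_mem_nhdsWithin, M + 1, ?_⟩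
      rintro ⟨t, y⟩ ⟨hp, ht, -⟩ x hx hxt s hs
      simp only at ht hs hxt hp
      subst hxt
      have hLT : IntervalIntegrable L volume 0 T :=
        (intervalIntegrable_iff_integrableOn_Icc_of_le (ht.1.trans ht.2)).2 (hLi T)
      have hLt : IntervalIntegrable L volume 0 t :=
        (intervalIntegrable_iff_integrableOn_Icc_of_le ht.1).2 (hLi t)
      have h1 : ∫ r in (0 : ℝ)..t, L r ≤ ∫ r in (0 : ℝ)..T, L r :=
        intervalIntegral.integral_mono_interval le_rfl ht.1 ht.2
          (Filter.Eventually.of_forall hL0) hLT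
      have hzM : ∀ r ∈ Icc 0 t, ‖z r‖ ≤ M := fun r hr => hM r ⟨hr.1, hr.2.trans ht.2⟩
      have h2 : ‖z t - x t‖ * Real.exp (∫ r in (0 : ℝ)..t, L r) < 1 := by
        refine lt_of_le_of_lt ?_ hp
        simp only [Λ]
        gcongr
      have h3 := hz.norm_sub_lt_one hx hzM hLt hL0 hLL h2 s hs
      have h4 := norm_sub_norm_le (x s) (z s)
      rw [norm_sub_rev] at h4
      have := hzM s hs
      linarith
  obtain ⟨R, hR⟩ := main
  exact ⟨R, fun t ht x hx hxt => hR (t, x t) ⟨ht, by simpa using hxt⟩ x hx rfl⟩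

/-- A Carathéodory function evaluated along a measurable map is measurable. -/
lemma measurable_caratheodory_comp {X Y : Type*} [TopologicalSpace X]
    [TopologicalSpace.MetrizableSpace X] [MeasurableSpace X] [SecondCountableTopology X]
    [OpensMeasurableSpace X] [TopologicalSpace Y] [TopologicalSpace.PseudoMetrizableSpace Y]
    [MeasurableSpace Y] [BorelSpace Y] {b : ℝ → X → Y} (hm : ∀ x, Measurable fun t => b t x)
    (hc : ∀ t, Continuous (b t)) {u : ℝ → X} (hu : Measurable u) :
    Measurable fun t => b t (u t) :=
  (measurable_uncurry_of_continuous_of_measurable (u := fun x t => b t x) hc hm).comp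
    (hu.prodMk measurable_id)

/-- The largest deviation `‖a(t,y,v) - a(t,y,u₀(t))‖` over a closed ball is a Carathéodory
function. -/
lemma exists_caratheodory_deviation {E V : Type*} [NormedAddCommGroup E] [NormedSpace ℝ E]
    [FiniteDimensional ℝ E] [MeasurableSpace E] [BorelSpace E] [NormedAddCommGroup V]
    [MeasurableSpace V] [BorelSpace V] [SecondCountableTopology V]
    {a : ℝ → E → V → E} (hameas : ∀ (y : E) (v : V), Measurable fun t => a t y v)
    (hacont : ∀ t : ℝ, Continuous fun p : E × V => a t p.1 p.2)
    {u0 : ℝ → V} (hu0 : Measurable u0) (ρ : ℝ) :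
    ∃ S : ℝ → V → ℝ, (∀ v, Measurable fun t => S t v) ∧ (∀ t, Continuous (S t)) ∧
      (∀ t v, 0 ≤ S t v) ∧ (∀ t, S t (u0 t) = 0) ∧
      (∀ t v y, ‖y‖ ≤ ρ → ‖a t y v - a t y (u0 t)‖ ≤ S t v) ∧
      ∀ t v M, 0 ≤ M → (∀ y, ‖y‖ ≤ ρ → ‖a t y v - a t y (u0 t)‖ ≤ M) → S t v ≤ M := by
  have : ProperSpace E := FiniteDimensional.proper ℝ E
  let B := Metric.closedBall (0 : E) ρ
  have hB : IsCompact B := isCompact_closedBall _ _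
  have : CompactSpace B := isCompact_iff_compactSpace.1 hB
  have hjoint : ∀ t, Continuous fun p : V × B => a t p.2 p.1 - a t p.2 (u0 t) := fun t =>
    ((hacont t).comp ((continuous_subtype_val.comp continuous_snd).prodMk continuous_fst)).sub
      ((hacont t).comp ((continuous_subtype_val.comp continuous_snd).prodMk continuous_const))
  let D : ℝ → V → C(B, E) := fun t => ContinuousMap.curry ⟨_, hjoint t⟩
  have hD : ∀ t v (y : B), D t v y = a t y v - a t y (u0 t) := fun t v y => rfl
  refine ⟨fun t v => ‖D t v‖, fun v => ?_, fun t => (ContinuousMap.continuous _).norm,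
    fun t v => norm_nonneg _, fun t => ?_, fun t v y hy => ?_, fun t v M hM h => ?_⟩
  · rcases isEmpty_or_nonempty B with hemp | hne
    · have : ∀ t, D t v = 0 := fun t => by
        ext y
        exact hemp.elim y
      simp [this]
    · obtain ⟨e, he⟩ := TopologicalSpace.exists_dense_seq B
      have hsup : ∀ t, ‖D t v‖ = ⨆ i, ‖D t v (e i)‖ := by
        intro t
        have hbdd : BddAbove (range fun i => ‖D t v (e i)‖) :=
          ⟨‖D t v‖, by rintro _ ⟨i, rfl⟩; exact (D t v).norm_coe_le_norm _⟩
        refine le_antisymm ?_ (ciSup_le fun i => (D t v).norm_coe_le_norm _)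
        refine (ContinuousMap.norm_le _ ((norm_nonneg _).trans (le_ciSup hbdd 0))).2 fun y => ?_
        refine he.induction_on (p := fun y => ‖D t v y‖ ≤ ⨆ i, ‖D t v (e i)‖) y ?_ ?_
        · exact isClosed_le (D t v).continuous.norm continuous_const
        · exact fun i => le_ciSup hbdd i
      simp_rw [hsup, hD]
      refine Measurable.iSup fun i => ((hameas _ v).sub ?_).norm
      exact measurable_caratheodory_comp (b := fun t v => a t (e i) v) (hameas _)
        (fun t => (hacont t).comp (continuous_const.prodMk continuous_id)) hu0
  · have : D t (u0 t) = 0 := by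
      ext y
      simp [hD]
    simp [this]
  · exact (D t v).norm_coe_le_norm ⟨y, by simpa [B] using hy⟩
  · exact (ContinuousMap.norm_le _ hM).2 fun y => h y (mem_closedBall_zero_iff.1 y.2)

/-- A continuous function satisfying the integral equation of a controlled Carathéodory system is
a solution, in particular the integrand is integrable. -/
lemma isCaratheodorySolution_of_eq {E V : Type*} [NormedAddCommGroup E] [NormedSpace ℝ E]
    [FiniteDimensional ℝ E] [MeasurableSpace E] [BorelSpace E] [NormedAddCommGroup V]
    [MeasurableSpace V] [BorelSpace V] [SecondCountableTopology V]
    {a : ℝ → E → V → E} (hameas : ∀ (y : E) (v : V), Measurable fun t => a t y v)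
    (hacont : ∀ t : ℝ, Continuous fun p : E × V => a t p.1 p.2)
    {U : ℝ → Set V}
    (haMaj : ∀ R : ℝ, ∃ Mj : ℝ → ℝ, (∀ T : ℝ, IntegrableOn Mj (Icc 0 T)) ∧
        ∀ t ≥ (0:ℝ), ∀ v ∈ U t, ∀ y : E, ‖y‖ ≤ R → ‖a t y v‖ ≤ Mj t)
    {u : ℝ → V} (hu : Measurable u) (huU : ∀ᵐ t ∂(volume.restrict (Ici (0:ℝ))), u t ∈ U t)
    {x : ℝ → E} (hx : ContinuousOn x (Ici 0)) {t₀ : ℝ} (ht₀ : 0 ≤ t₀) {x₀ : E}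
    (h : ∀ t ≥ (0:ℝ), x t = x₀ + ∫ s in t₀..t, a s (x s) (u s)) :
    IsCaratheodorySolution (fun t y => a t y (u t)) x := by
  have : ProperSpace E := FiniteDimensional.proper ℝ E
  have hmeas : AEStronglyMeasurable (fun t => a t (x t) (u t)) (volume.restrict (Ici (0:ℝ))) := by
    have h1 : AEMeasurable x (volume.restrict (Ici (0:ℝ))) := hx.aemeasurable measurableSet_Ici
    have h2 : Measurable fun p : (E × V) × ℝ => a p.2 p.1.1 p.1.2 :=
      measurable_uncurry_of_continuous_of_measurable
        (u := fun (q : E × V) t => a t q.1 q.2) hacont fun q => hameas q.1 q.2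
    exact (h2.comp_aemeasurable ((h1.prodMk hu.aemeasurable).prodMk
      aemeasurable_id)).aestronglyMeasurable
  have hint0 : ∀ T ≥ (0 : ℝ), IntervalIntegrable (fun t => a t (x t) (u t)) volume 0 T := by
    intro T hT
    have hsub : Icc 0 T ⊆ Ici (0 : ℝ) := fun r hr => hr.1
    obtain ⟨M, hM⟩ := isCompact_Icc.exists_bound_of_continuousOn (hx.mono hsub)
    obtain ⟨Mj, hMj, hb⟩ := haMaj M
    rw [intervalIntegrable_iff_integrableOn_Icc_of_le hT]
    refine (hMj T).mono' (hmeas.mono_measure (Measure.restrict_mono_set _ hsub)) ?_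
    rw [ae_restrict_iff' measurableSet_Icc]
    rw [ae_restrict_iff' measurableSet_Ici] at huU
    filter_upwards [huU] with t ht htT
    exact hb t htT.1 _ (ht htT.1) _ (hM t htT)
  have hint : ∀ s ≥ (0 : ℝ), ∀ t ≥ (0 : ℝ),
      IntervalIntegrable (fun t => a t (x t) (u t)) volume s t :=
    fun s hs t ht => (hint0 s hs).symm.trans (hint0 t ht)
  refine ⟨hx, hint, fun s hs t ht => ?_⟩
  rw [h t ht, h s hs, add_assoc, integral_add_adjacent_intervals (hint _ ht₀ _ hs) (hint _ hs _ ht)]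

/-- Let `z` and `z'` solve `ẋ = f(t,x)` and agree at times `τ` and `s ≤ τ` with a solution `x` of
`ẋ = g(t,x)`. Then `z 0` and `z' 0` differ by at most a multiple of the integral of `f - g`
along `x`. -/
lemma IsCaratheodorySolution.norm_sub_zero_le {E : Type*} [NormedAddCommGroup E] [NormedSpace ℝ E]
    {f g : ℝ → E → E} {z z' x : ℝ → E} {L d : ℝ → ℝ} {R s τ T : ℝ}
    (hz : IsCaratheodorySolution f z) (hz' : IsCaratheodorySolution f z')
    (hx : IsCaratheodorySolution g x) (hs : 0 ≤ s) (hsτ : s ≤ τ) (hτT : τ ≤ T)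
    (hzx : z τ = x τ) (hzx' : z' s = x s)
    (hzR : ∀ r ∈ Icc 0 τ, ‖z r‖ ≤ R) (hzR' : ∀ r ∈ Icc 0 s, ‖z' r‖ ≤ R)
    (hxR : ∀ r ∈ Icc s τ, ‖x r‖ ≤ R)
    (hL : IntervalIntegrable L volume 0 T) (hL0 : ∀ r, 0 ≤ L r)
    (hLip : ∀ᵐ r ∂volume.restrict (Ici (0 : ℝ)), ∀ y₁ y₂ : E, ‖y₁‖ ≤ R → ‖y₂‖ ≤ R →
      ‖f r y₁ - f r y₂‖ ≤ L r * ‖y₁ - y₂‖)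
    (hd : IntervalIntegrable d volume s τ) (hd0 : ∀ r, 0 ≤ d r)
    (hfg : ∀ r ∈ Icc s τ, ‖f r (x r) - g r (x r)‖ ≤ d r) :
    ‖z 0 - z' 0‖ ≤ Real.exp (∫ r in (0 : ℝ)..T, L r) ^ 2 * ∫ r in s..τ, d r := by
  have hT : 0 ≤ T := hs.trans (hsτ.trans hτT)
  have hsub : ∀ p q, 0 ≤ p → p ≤ q → q ≤ T → uIcc p q ⊆ uIcc 0 T := by
    intro p q hp hpq hq
    rw [uIcc_of_le hpq, uIcc_of_le hT]
    exact Icc_subset_Icc hp hq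
  have hexp : ∀ p q, 0 ≤ p → p ≤ q → q ≤ T →
      Real.exp (∫ r in p..q, L r) ≤ Real.exp (∫ r in (0 : ℝ)..T, L r) := fun p q hp hpq hq =>
    Real.exp_le_exp.2 (intervalIntegral.integral_mono_interval hp hpq hq
      (Filter.Eventually.of_forall hL0) hL)
  have hd' : 0 ≤ ∫ r in s..τ, d r := intervalIntegral.integral_nonneg hsτ fun r _ => hd0 r
  have h1 := hz.norm_sub_le hx hs hsτ (fun r hr => hzR r ⟨hs.trans hr.1.le, hr.2.le⟩)
    (fun r hr => hxR r (Ioo_subset_Icc_self hr)) (hL.mono_set (hsub s τ hs hsτ hτT)) hL0 hLip hd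
    hd0 (fun r hr => hfg r (Ioo_subset_Icc_self hr))
  have h2 := hz.norm_sub_le (d := fun _ => 0) hz' le_rfl hs
    (fun r hr => hzR r ⟨hr.1.le, hr.2.le.trans hsτ⟩)
    (fun r hr => hzR' r (Ioo_subset_Icc_self hr))
    (hL.mono_set (hsub 0 s le_rfl hs (hsτ.trans hτT))) hL0 hLip intervalIntegrable_const
    (fun _ => le_rfl) (by simp)
  rw [hzx, sub_self, norm_zero, zero_add, ← hzx'] at h1
  rw [intervalIntegral.integral_zero, add_zero] at h2
  calc ‖z 0 - z' 0‖ ≤ ‖z s - z' s‖ * Real.exp (∫ r in (0 : ℝ)..s, L r) := h2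
    _ ≤ ((∫ r in s..τ, d r) * Real.exp (∫ r in (0 : ℝ)..T, L r)) *
        Real.exp (∫ r in (0 : ℝ)..T, L r) := by
      refine mul_le_mul (h1.trans ?_) (hexp 0 s le_rfl hs (hsτ.trans hτT)) (Real.exp_pos _).le
        (mul_nonneg hd' (Real.exp_pos _).le)
      exact mul_le_mul_of_nonneg_left (hexp s τ hs hsτ hτT) hd'
    _ = _ := by ring

/-- **Proposition `dop`: existence of a weight function.**  `E` is a
finite-dimensional Euclidean space; `U` is a compact-valued multifunction with
closed Borel graph, bounded on compact time intervals; admissible controls are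
its measurable selectors; `a` is a Carathéodory right-hand side, locally
Lipschitz in `y` with locally integrable constants and majorants, whose
solutions extend to all of `[0,∞)`; `κ(t*,y*)` is the value at time `0` of the
solution of `ẏ = a(t,y,u⁰(t))` through `(t*,y*)`; `G` is a compact-valued tube
with closed Borel graph, bounded on compact time intervals.  Then there is a
nonnegative Carathéodory weight `w⁰` vanishing along `u⁰`, whose vanishing
integral `𝓛_{w⁰}[u](τ) = 0` forces `u = u⁰` a.e. on `[0,τ]`, and which
controls the drift of `κ(τ, y(τ))` for every admissible `u` whose trajectory
stays in the tube `G`. -/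
theorem exists_weight_controlling_pullback
    {E : Type*} [NormedAddCommGroup E] [InnerProductSpace ℝ E]
    [FiniteDimensional ℝ E] [MeasurableSpace E] [BorelSpace E]
    (k : ℕ)
    (U : ℝ → Set (Fin k → ℝ))
    (hUne : ∀ t ≥ (0:ℝ), (U t).Nonempty)
    (hUcomp : ∀ t ≥ (0:ℝ), IsCompact (U t))
    (hUbdd : ∀ T : ℝ, ∃ C : ℝ, ∀ t ∈ Icc (0:ℝ) T, ∀ v ∈ U t, ‖v‖ ≤ C)
    (hUgc : IsClosed {p : ℝ × (Fin k → ℝ) | 0 ≤ p.1 ∧ p.2 ∈ U p.1})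
    (hUgm : MeasurableSet {p : ℝ × (Fin k → ℝ) | 0 ≤ p.1 ∧ p.2 ∈ U p.1})
    (Adm : (ℝ → Fin k → ℝ) → Prop)
    (hAdm : ∀ u, Adm u ↔ Measurable u ∧
        ∀ᵐ t ∂(volume.restrict (Ici (0:ℝ))), u t ∈ U t)
    (a : ℝ → E → (Fin k → ℝ) → E)
    (hameas : ∀ (y : E) (v : Fin k → ℝ), Measurable fun t => a t y v)
    (hacont : ∀ t : ℝ, Continuous fun p : E × (Fin k → ℝ) => a t p.1 p.2)
    (haLip : ∀ R : ℝ, ∃ L : ℝ → ℝ, (∀ t, 0 ≤ L t) ∧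
        (∀ T : ℝ, IntegrableOn L (Icc 0 T)) ∧
        ∀ t ≥ (0:ℝ), ∀ v ∈ U t, ∀ y₁ y₂ : E, ‖y₁‖ ≤ R → ‖y₂‖ ≤ R →
          ‖a t y₁ v - a t y₂ v‖ ≤ L t * ‖y₁ - y₂‖)
    (haMaj : ∀ R : ℝ, ∃ Mj : ℝ → ℝ, (∀ T : ℝ, IntegrableOn Mj (Icc 0 T)) ∧
        ∀ t ≥ (0:ℝ), ∀ v ∈ U t, ∀ y : E, ‖y‖ ≤ R → ‖a t y v‖ ≤ Mj t)
    (haExt : ∀ u, Adm u → ∀ tstar ≥ (0:ℝ), ∀ ystar : E, ∃ Y : ℝ → E,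
        ContinuousOn Y (Ici 0) ∧ Y tstar = ystar ∧
        ∀ t ≥ (0:ℝ), Y t = ystar + ∫ s in tstar..t, a s (Y s) (u s))
    (u0 : ℝ → Fin k → ℝ) (hu0 : Adm u0)
    (κ : ℝ → E → E)
    (hκ : ∀ tstar ≥ (0:ℝ), ∀ ystar : E, ∃ Y : ℝ → E,
        ContinuousOn Y (Ici 0) ∧ Y tstar = ystar ∧
        (∀ t ≥ (0:ℝ), Y t = ystar + ∫ s in tstar..t, a s (Y s) (u0 s)) ∧
        κ tstar ystar = Y 0)
    (G : ℝ → Set E)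
    (hGcomp : ∀ t ≥ (0:ℝ), IsCompact (G t))
    (hGbdd : ∀ T : ℝ, ∃ C : ℝ, ∀ t ∈ Icc (0:ℝ) T, ∀ y ∈ G t, ‖y‖ ≤ C)
    (hGgc : IsClosed {p : ℝ × E | 0 ≤ p.1 ∧ p.2 ∈ G p.1})
    (hGgm : MeasurableSet {p : ℝ × E | 0 ≤ p.1 ∧ p.2 ∈ G p.1}) :
    ∃ w0 : ℝ → (Fin k → ℝ) → ℝ,
      (∀ v : Fin k → ℝ, Measurable fun t => w0 t v) ∧
      (∀ t : ℝ, Continuous fun v => w0 t v) ∧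
      (∀ t v, 0 ≤ w0 t v) ∧
      (∀ᵐ t ∂(volume.restrict (Ici (0:ℝ))), w0 t (u0 t) = 0) ∧
      (∀ u, Adm u → ∀ τ ≥ (0:ℝ), (∫ t in (0:ℝ)..τ, w0 t (u t)) = 0 →
        ∀ᵐ t ∂(volume.restrict (Icc (0:ℝ) τ)), u t = u0 t) ∧
      (∀ u, Adm u → ∀ ξ : E, ∀ T ≥ (0:ℝ), ∀ y : ℝ → E,
        ContinuousOn y (Ici 0) → y 0 = ξ →
        (∀ t ≥ (0:ℝ), y t = ξ + ∫ s in (0:ℝ)..t, a s (y s) (u s)) →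
        (∀ t ∈ Icc (0:ℝ) T, y t ∈ G t) →
        ∀ τ ∈ Icc (0:ℝ) T, ‖κ τ (y τ) - ξ‖ ≤ ∫ t in (0:ℝ)..τ, w0 t (u t)) := by
  have hProper : ProperSpace E := FiniteDimensional.proper ℝ E
  obtain ⟨hu0m, hu0U⟩ := (hAdm u0).1 hu0
  let f : ℝ → E → E := fun t y => a t y (u0 t)
  have hsol : ∀ u, Adm u → ∀ t₀ ≥ (0 : ℝ), ∀ x₀ : E, ∀ x : ℝ → E, ContinuousOn x (Ici 0) →
      (∀ t ≥ (0:ℝ), x t = x₀ + ∫ s in t₀..t, a s (x s) (u s)) →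
      IsCaratheodorySolution (fun t y => a t y (u t)) x := fun u hu t₀ ht₀ x₀ x hx h =>
    isCaratheodorySolution_of_eq hameas hacont haMaj ((hAdm u).1 hu).1 ((hAdm u).1 hu).2 hx ht₀ h
  have hLip : ∀ R : ℝ, ∃ L : ℝ → ℝ, (∀ t, 0 ≤ L t) ∧ (∀ T : ℝ, IntegrableOn L (Icc 0 T)) ∧
      ∀ᵐ r ∂volume.restrict (Ici (0 : ℝ)), ∀ y₁ y₂ : E, ‖y₁‖ ≤ R → ‖y₂‖ ≤ R →
        ‖f r y₁ - f r y₂‖ ≤ L r * ‖y₁ - y₂‖ := by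
    intro R
    obtain ⟨L, hL0, hLi, hL⟩ := haLip R
    refine ⟨L, hL0, hLi, ?_⟩
    filter_upwards [hu0U, ae_restrict_mem measurableSet_Ici] with r hr hr0
    exact hL r hr0 _ hr
  have hκ' : ∀ t ≥ (0 : ℝ), ∀ y : E, ∃ x, IsCaratheodorySolution f x ∧ x t = y ∧ κ t y = x 0 := by
    intro t ht y
    obtain ⟨x, hx, hxt, hxe, hx0⟩ := hκ t ht y
    exact ⟨x, hsol u0 hu0 t ht y x hx hxe, hxt, hx0⟩
  have hex : ∀ t ≥ (0 : ℝ), ∀ y : E, ∃ x, IsCaratheodorySolution f x ∧ x t = y := fun t ht y =>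
    (hκ' t ht y).imp fun x hx => ⟨hx.1, hx.2.1⟩
  choose ρ hρ using fun n : ℕ => hGbdd ((n : ℝ) + 1)
  choose R hR using fun n : ℕ => exists_bound_backward_solutions hLip hex ((n : ℝ) + 1) (ρ n)
  choose L hL0 hLi hLL using fun n : ℕ => hLip (max (R n) (ρ n))
  choose S hSm hSc hS0 hSu hSle hSM using
    fun n : ℕ => exists_caratheodory_deviation hameas hacont hu0m (ρ n)
  let C : ℕ → ℝ := fun n => Real.exp (∫ r in (0 : ℝ)..((n : ℝ) + 1), L n r) ^ 2
  have hC : ∀ n, 0 ≤ C n := fun n => by positivity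
  let w : ℝ → (Fin k → ℝ) → ℝ := fun t v => C ⌊t⌋₊ * S ⌊t⌋₊ t v + min 1 ‖v - u0 t‖
  have hmin : ∀ t v, 0 ≤ min 1 ‖v - u0 t‖ := fun t v => le_min zero_le_one (norm_nonneg _)
  have hCS : ∀ n t v, 0 ≤ C n * S n t v := fun n t v => mul_nonneg (hC n) (hS0 n t v)
  have hw0 : ∀ t v, 0 ≤ w t v := fun t v => add_nonneg (hCS _ _ _) (hmin t v)
  have hwm : ∀ v, Measurable fun t => w t v := by
    intro v
    have h1 : Measurable fun p : ℕ × ℝ => C p.1 * S p.1 p.2 v :=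
      measurable_from_prod_countable_right fun n => (hSm n v).const_mul (C n)
    exact (h1.comp (Nat.measurable_floor.prodMk measurable_id)).add
      (measurable_const.min (measurable_const.sub hu0m).norm)
  have hwc : ∀ t, Continuous fun v => w t v := fun t =>
    ((hSc _ t).const_mul _).add (continuous_const.min (continuous_id.sub continuous_const).norm)
  have hSint : ∀ u, Adm u → ∀ n T, IntegrableOn (fun t => S n t (u t)) (Icc 0 T) := by
    intro u hu n T
    obtain ⟨hum, huU⟩ := (hAdm u).1 hu
    obtain ⟨Mj, hMj, hb⟩ := haMaj (ρ n)
    refine ((hMj T).abs.const_mul 2).mono'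
      (measurable_caratheodory_comp (hSm n) (hSc n) hum).aestronglyMeasurable ?_
    rw [ae_restrict_iff' measurableSet_Icc]
    rw [ae_restrict_iff' measurableSet_Ici] at huU hu0U
    filter_upwards [huU, hu0U] with t ht ht' htT
    rw [Real.norm_of_nonneg (hS0 n t _)]
    refine hSM n t _ _ (by positivity) fun y hy => ?_
    have h1 := (hb t htT.1 _ (ht htT.1) y hy).trans (le_abs_self _)
    have h2 := (hb t htT.1 _ (ht' htT.1) y hy).trans (le_abs_self _)
    have h3 := norm_sub_le (a t y (u t)) (a t y (u0 t))
    linarith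
  have hwint : ∀ u, Adm u → ∀ T, IntegrableOn (fun t => w t (u t)) (Icc 0 T) := by
    intro u hu T
    have hum := ((hAdm u).1 hu).1
    have hbd : IntegrableOn
        (fun t => (∑ n ∈ Finset.range (⌊T⌋₊ + 1), C n * S n t (u t)) + 1) (Icc 0 T) :=
      (integrable_finsetSum _ fun n _ => (hSint u hu n T).const_mul (C n)).add
        (integrableOn_const (by simp))
    refine hbd.mono' (measurable_caratheodory_comp hwm hwc hum).aestronglyMeasurable ?_
    rw [ae_restrict_iff' measurableSet_Icc]
    refine Filter.Eventually.of_forall fun t ht => ?_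
    rw [Real.norm_of_nonneg (hw0 t _)]
    refine add_le_add ?_ (min_le_left _ _)
    exact Finset.single_le_sum (f := fun n => C n * S n t (u t)) (fun n _ => hCS n t _)
      (Finset.mem_range.2 (Nat.lt_succ_of_le (Nat.floor_mono ht.2)))
  have hwii : ∀ u, Adm u → ∀ s ≥ (0 : ℝ), ∀ t ≥ s,
      IntervalIntegrable (fun t => w t (u t)) volume s t := by
    intro u hu s hs t hst
    rw [intervalIntegrable_iff_integrableOn_Icc_of_le hst]
    exact (hwint u hu t).mono_set (Icc_subset_Icc_left hs)
  refine ⟨w, hwm, hwc, hw0, Filter.Eventually.of_forall fun t => ?_, ?_, ?_⟩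
  · simp [w, hSu]
  · intro u hu τ hτ h0
    rw [intervalIntegral.integral_of_le hτ, ← integral_Icc_eq_integral_Ioc,
      integral_eq_zero_iff_of_nonneg (fun t => hw0 t _) (hwint u hu τ)] at h0
    filter_upwards [h0] with t ht
    have h1 : C ⌊t⌋₊ * S ⌊t⌋₊ t (u t) + min 1 ‖u t - u0 t‖ = 0 := ht
    have h2 : min 1 ‖u t - u0 t‖ ≤ 0 := by linarith [hCS ⌊t⌋₊ t (u t)]
    rcases min_le_iff.1 h2 with h3 | h3
    · exact absurd h3 (by norm_num)
    · exact sub_eq_zero.1 (norm_le_zero_iff.1 h3)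
  · intro u hu ξ T hT y hy hy0 hye hyG
    have hys := hsol u hu 0 le_rfl ξ y hy hye
    have step : ∀ (n : ℕ) (τ : ℝ), (n : ℝ) ≤ τ → τ ≤ n + 1 → τ ≤ T →
        ‖κ τ (y τ) - κ n (y n)‖ ≤ ∫ t in (n : ℝ)..τ, w t (u t) := by
      intro n τ hnτ hτn hτT
      have hn : (0 : ℝ) ≤ n := n.cast_nonneg
      have hτ : 0 ≤ τ := hn.trans hnτ
      obtain ⟨z, hz, hzτ, hz0⟩ := hκ' τ hτ (y τ)
      obtain ⟨z', hz', hzn', hz0'⟩ := hκ' n hn (y n)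
      rw [hz0, hz0']
      have hyρ : ∀ r ∈ Icc (n : ℝ) τ, ‖y r‖ ≤ ρ n := fun r hr =>
        hρ n r ⟨hn.trans hr.1, hr.2.trans hτn⟩ _ (hyG r ⟨hn.trans hr.1, hr.2.trans hτT⟩)
      have hSii : IntervalIntegrable (fun t => S n t (u t)) volume n τ := by
        rw [intervalIntegrable_iff_integrableOn_Icc_of_le hnτ]
        exact (hSint u hu n τ).mono_set (Icc_subset_Icc_left hn)
      have h1 := hz.norm_sub_zero_le hz' hys hn hnτ hτn hzτ hzn'
        (R := max (R n) (ρ n)) (L := L n) (d := fun t => S n t (u t))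
        (fun r hr => (hR n τ ⟨hτ, hτn⟩ z hz (hzτ ▸ hyρ τ (right_mem_Icc.2 hnτ)) r hr).trans
          (le_max_left _ _))
        (fun r hr => (hR n n ⟨hn, by linarith⟩ z' hz' (hzn' ▸ hyρ n (left_mem_Icc.2 hnτ)) r
          hr).trans (le_max_left _ _))
        (fun r hr => (hyρ r hr).trans (le_max_right _ _))
        ((intervalIntegrable_iff_integrableOn_Icc_of_le (by positivity)).2 (hLi n _))
        (hL0 n) (hLL n) hSii (fun r => hS0 n r _)
        (fun r hr => by
          rw [norm_sub_rev]
          exact hSle n r (u r) (y r) (hyρ r hr))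
      refine h1.trans ?_
      rw [← intervalIntegral.integral_const_mul]
      refine intervalIntegral.integral_mono_on_of_le_Ioo hnτ (hSii.const_mul _)
        (hwii u hu n hn τ hnτ) fun t ht => ?_
      have hfl : ⌊t⌋₊ = n :=
        (Nat.floor_eq_iff (hn.trans ht.1.le)).2 ⟨ht.1.le, ht.2.trans_le hτn⟩
      simp only [w, hfl]
      exact le_add_of_nonneg_right (hmin t _)
    have hκ0 : κ 0 (y 0) = ξ := by
      obtain ⟨x, -, hx, hx0⟩ := hκ' 0 le_rfl (y 0)
      rw [hx0, hx, hy0]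
    have chain : ∀ (n : ℕ) (τ : ℝ), (n : ℝ) ≤ τ → τ ≤ n + 1 → τ ≤ T →
        ‖κ n (y n) - ξ‖ ≤ ∫ t in (0 : ℝ)..n, w t (u t) →
        ‖κ τ (y τ) - ξ‖ ≤ ∫ t in (0 : ℝ)..τ, w t (u t) := by
      intro n τ hnτ hτn hτT hn
      rw [← integral_add_adjacent_intervals (hwii u hu 0 le_rfl n n.cast_nonneg)
        (hwii u hu n n.cast_nonneg τ hnτ), ← sub_add_sub_cancel _ (κ n (y n)) ξ]
      linarith [norm_add_le (κ τ (y τ) - κ n (y n)) (κ n (y n) - ξ), step n τ hnτ hτn hτT]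
    have hnat : ∀ n : ℕ, (n : ℝ) ≤ T → ‖κ n (y n) - ξ‖ ≤ ∫ t in (0 : ℝ)..n, w t (u t) := by
      intro n
      induction n with
      | zero => simp [hκ0]
      | succ n ih =>
        intro hn
        push_cast at hn ⊢
        exact chain n _ (by linarith) le_rfl hn (ih (by linarith))
    intro τ hτ
    have h1 := Nat.floor_le hτ.1
    exact chain ⌊τ⌋₊ τ h1 (Nat.lt_floor_add_one τ).le hτ.2 (hnat _ (h1.trans hτ.2))
end

section
/- Let G₀ ⊆ E be closed and K₀ ⊆ G₀ compact. Assume that for every ξ ∈ K₀ the solution y^{u⁰}_ξ has a Lyapunov-stable p-component in G₀: for every ε > 0 there is δ > 0 such that ξ' ∈ G₀ and ‖ξ' − ξ‖ < δ imply ‖p^{u⁰}_{ξ'}(s) − p^{u⁰}_ξ(s)‖ < ε for all s ≥ 0. Then there exists a Carathéodory weight w⁰ : [0,∞)×ℝ^k → [0,∞) with w⁰(t,u⁰(t)) = 0 a.e. such that for every ε > 0 there is δ > 0 with the property: for all ξ ∈ K₀ and all u ∈ O_{w⁰}(u⁰; δ), if κ(t, y^u_ξ(t)) ∈ G₀ for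 all t ≥ 0, then sup_{t≥0} ‖p^u_ξ(t) − p^{u⁰}_ξ(t)‖ < ε. -/
open MeasureTheory Set intervalIntegral

/-- A local Grönwall-type bound that only holds while `φ ≤ 1` propagates forward as long as the
resulting exponential bound stays below `1`. -/
theorem le_exp_of_local_bound {φ ℓ m : ℝ → ℝ} {a b c : ℝ}
    (hφ : ContinuousOn φ (Icc a b)) (hφ0 : ∀ t ∈ Icc a b, 0 ≤ φ t)
    (hℓ : ContinuousOn ℓ (Icc a b)) (hℓm : MonotoneOn ℓ (Icc a b))
    (hm : ContinuousOn m (Icc a b)) (hmm : MonotoneOn m (Icc a b))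
    (hloc : ∀ s ∈ Icc a b, ∀ t ∈ Icc s b, ∀ M ≤ 1, (∀ r ∈ Icc s t, φ r ≤ M) →
      φ t ≤ φ s + M * (ℓ t - ℓ s) + (m t - m s))
    (hc : φ a ≤ c) (hsmall : (c + (m b - m a)) * Real.exp (2 * (ℓ b - ℓ a)) < 1) :
    ∀ t ∈ Icc a b, φ t ≤ (c + (m t - m a)) * Real.exp (2 * (ℓ t - ℓ a)) := by
  rcases lt_or_ge b a with hab | hab
  · intro t ht
    exact absurd (ht.1.trans ht.2) (not_le.2 hab)
  have ha : a ∈ Icc a b := left_mem_Icc.2 hab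
  have hb : b ∈ Icc a b := right_mem_Icc.2 hab
  have hc0 : 0 ≤ c := (hφ0 a ha).trans hc
  set B : ℝ → ℝ := fun t => (c + (m t - m a)) * Real.exp (2 * (ℓ t - ℓ a)) with hB
  have hBc : ContinuousOn B (Icc a b) := by
    have := Real.continuous_exp
    fun_prop
  have hBb : ∀ t ∈ Icc a b, B t < 1 := by
    intro t ht
    refine lt_of_le_of_lt ?_ hsmall
    have h1 := hmm ht hb ht.2
    have h2 := hℓm ht hb ht.2
    have h3 := hmm ha ht ht.1
    simp only [hB]
    gcongr
    linarith
  have hcl : IsClosed ({t | φ t ≤ B t} ∩ Icc a b) := by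
    have := isClosed_Icc.isClosed_le hφ hBc
    convert this using 1
    ext t; simp [and_comm]
  refine hcl.Icc_subset_of_forall_exists_gt (by simpa [hB] using hc) ?_
  rintro x ⟨hx, hxI⟩ y hy
  have hxab : x ∈ Icc a b := ⟨hxI.1, hxI.2.le⟩
  have hnb : Icc a b ∈ nhdsWithin x (Ici x) :=
    Filter.mem_of_superset (Icc_mem_nhdsGE hxI.2) (Icc_subset_Icc_left hxI.1)
  have hφx : ContinuousWithinAt φ (Ici x) x := (hφ x hxab).mono_of_mem_nhdsWithin hnb
  have hℓx : ContinuousWithinAt ℓ (Ici x) x := (hℓ x hxab).mono_of_mem_nhdsWithin hnb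
  have e1 : ∀ᶠ t in nhdsWithin x (Ici x), φ t < 1 :=
    hφx.eventually (gt_mem_nhds (lt_of_le_of_lt hx (hBb x hxab)))
  have e2 : ∀ᶠ t in nhdsWithin x (Ici x), ℓ t < ℓ x + 1 / 2 :=
    hℓx.eventually (gt_mem_nhds (by linarith))
  obtain ⟨v, hv, hsubv⟩ := mem_nhdsGE_iff_exists_Icc_subset.1 (e1.and e2)
  obtain ⟨u, hxu, hu⟩ : ∃ u, x < u ∧ u ≤ min v (min b y) :=
    ⟨_, lt_min hv (lt_min hxI.2 hy), le_rfl⟩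
  have hub : u ≤ b := (hu.trans (min_le_right _ _)).trans (min_le_left _ _)
  have huy : u ≤ y := (hu.trans (min_le_right _ _)).trans (min_le_right _ _)
  have hsub := (Icc_subset_Icc_right (hu.trans (min_le_left _ _))).trans hsubv
  refine ⟨u, ?_, hxu, huy⟩
  have hsubI : Icc x u ⊆ Icc a b := Icc_subset_Icc hxI.1 hub
  have huab : u ∈ Icc a b := hsubI (right_mem_Icc.2 hxu.le)
  obtain ⟨r, hr, hmax⟩ := isCompact_Icc.exists_isMaxOn (nonempty_Icc.2 hxu.le) (hφ.mono hsubI)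
  have hrab := hsubI hr
  have hM0 := hφ0 r hrab
  have key := hloc x hxab r ⟨hr.1, hrab.2⟩ (φ r) (hsub hr).1.le
    (fun q hq => hmax ⟨hq.1, hq.2.trans hr.2⟩)
  have k1 := hℓm hrab huab hr.2
  have k2 := hmm hrab huab hr.2
  have k3 : ℓ u < ℓ x + 1 / 2 := (hsub (right_mem_Icc.2 hxu.le)).2
  have k4 := hℓm hxab huab hxu.le
  have k5 := hmm hxab huab hxu.le
  have k6 : φ u ≤ φ r := hmax (right_mem_Icc.2 hxu.le)
  have k7 := hmm ha hxab hxI.1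
  have k8 := hℓm ha hxab hxI.1
  set d := ℓ u - ℓ x with hd
  have hd0 : 0 ≤ d := by linarith
  have h1 : φ r * (1 - d) ≤ φ x + (m u - m x) := by
    nlinarith [mul_le_mul_of_nonneg_left (show ℓ r - ℓ x ≤ d by linarith) hM0]
  have h2 : 1 ≤ (1 - d) * Real.exp (2 * d) := by
    have := Real.add_one_le_exp (2 * d)
    nlinarith
  have h3 : φ r ≤ (φ x + (m u - m x)) * Real.exp (2 * d) := by
    have e0 := Real.exp_pos (2 * d)
    nlinarith [mul_le_mul_of_nonneg_right h1 e0.le, mul_le_mul_of_nonneg_left h2 hM0]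
  have h4 : φ x + (m u - m x) ≤ (c + (m u - m a)) * Real.exp (2 * (ℓ x - ℓ a)) := by
    have e1 : 1 ≤ Real.exp (2 * (ℓ x - ℓ a)) := Real.one_le_exp (by linarith)
    have hx' : φ x ≤ (c + (m x - m a)) * Real.exp (2 * (ℓ x - ℓ a)) := hx
    nlinarith
  calc φ u ≤ (φ x + (m u - m x)) * Real.exp (2 * d) := k6.trans h3
    _ ≤ (c + (m u - m a)) * Real.exp (2 * (ℓ x - ℓ a)) * Real.exp (2 * d) := by gcongr
    _ = B u := by
      simp only [hB, mul_assoc, ← Real.exp_add, hd]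
      ring_nf

/-- The backward-in-time counterpart of `le_exp_of_local_bound`. -/
theorem le_exp_of_local_bound_backward {φ ℓ : ℝ → ℝ} {a b c : ℝ}
    (hφ : ContinuousOn φ (Icc a b)) (hφ0 : ∀ t ∈ Icc a b, 0 ≤ φ t)
    (hℓ : ContinuousOn ℓ (Icc a b)) (hℓm : MonotoneOn ℓ (Icc a b))
    (hloc : ∀ s ∈ Icc a b, ∀ t ∈ Icc s b, ∀ M ≤ 1, (∀ r ∈ Icc s t, φ r ≤ M) →
      φ s ≤ φ t + M * (ℓ t - ℓ s))
    (hc : φ b ≤ c) (hsmall : c * Real.exp (2 * (ℓ b - ℓ a)) < 1) :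
    ∀ t ∈ Icc a b, φ t ≤ c * Real.exp (2 * (ℓ b - ℓ t)) := by
  have hneg : MapsTo (fun t : ℝ => -t) (Icc (-b) (-a)) (Icc a b) :=
    fun t ht => ⟨by linarith [ht.2], by linarith [ht.1]⟩
  have h := le_exp_of_local_bound (φ := fun t => φ (-t)) (ℓ := fun t => -ℓ (-t))
    (m := fun _ => 0) (a := -b) (b := -a) (c := c)
    (hφ.comp continuousOn_neg hneg) (fun t ht => hφ0 _ (hneg ht))
    (hℓ.comp continuousOn_neg hneg).neg
    (fun s hs t ht hst => neg_le_neg (hℓm (hneg ht) (hneg hs) (neg_le_neg hst)))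
    continuousOn_const monotoneOn_const
    (fun s hs t ht M hM hr => by
      have := hloc (-t) ⟨by linarith [ht.2], by linarith [ht.1, hs.1]⟩ (-s)
        ⟨by linarith [ht.1], by linarith [hs.1]⟩ M hM
        (fun r hr' => by
          simpa using hr (-r) ⟨by linarith [hr'.2], by linarith [hr'.1]⟩)
      linarith)
    (by simpa using hc)
    (by
      refine lt_of_eq_of_lt ?_ hsmall
      simp only [neg_neg]
      ring_nf)
  intro t ht
  have := h (-t) ⟨by linarith [ht.2], by linarith [ht.1]⟩
  simp only [neg_neg] at this
  refine this.trans_eq ?_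
  ring_nf

/-- Carathéodory right-hand side, locally Lipschitz in the state with locally integrable constants
and locally integrable majorants along the control constraint `U`. -/
structure IsCaratheodoryField {E V : Type*} [NormedAddCommGroup E] [MeasurableSpace E]
    [TopologicalSpace V] (U : ℝ → Set V) (a : ℝ → E → V → E) : Prop where
  measurable : ∀ y v, Measurable fun t => a t y v
  continuous : ∀ t, Continuous fun p : E × V => a t p.1 p.2
  lipschitz : ∀ R : ℝ, ∃ L : ℝ → ℝ, (∀ t, 0 ≤ L t) ∧ (∀ T : ℝ, IntegrableOn L (Icc 0 T)) ∧
    ∀ t ≥ (0:ℝ), ∀ v ∈ U t, ∀ y₁ y₂ : E, ‖y₁‖ ≤ R → ‖y₂‖ ≤ R →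
      ‖a t y₁ v - a t y₂ v‖ ≤ L t * ‖y₁ - y₂‖
  majorant : ∀ R : ℝ, ∃ M : ℝ → ℝ, (∀ T : ℝ, IntegrableOn M (Icc 0 T)) ∧
    ∀ t ≥ (0:ℝ), ∀ v ∈ U t, ∀ y : E, ‖y‖ ≤ R → ‖a t y v‖ ≤ M t

/-- Measurable selectors of `U` on `[0,∞)`. -/
def IsAdmissible {V : Type*} [MeasurableSpace V] (U : ℝ → Set V) (u : ℝ → V) : Prop :=
  Measurable u ∧ ∀ᵐ t ∂(volume.restrict (Ici (0:ℝ))), u t ∈ U t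

/-- `Y` solves `ẏ = a(t, y, u(t))` on `[0,∞)` in integral form. -/
def IsTrajectory {E V : Type*} [NormedAddCommGroup E] [NormedSpace ℝ E]
    (a : ℝ → E → V → E) (u : ℝ → V) (Y : ℝ → E) : Prop :=
  ContinuousOn Y (Ici 0) ∧
    ∀ s ≥ (0:ℝ), ∀ t ≥ (0:ℝ), Y t - Y s = ∫ r in s..t, a r (Y r) (u r)

theorem IsAdmissible.ae_mem {V : Type*} [MeasurableSpace V] {U : ℝ → Set V}
    {u : ℝ → V} (hu : IsAdmissible U u) :
    ∀ᵐ t, 0 ≤ t → u t ∈ U t :=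
  (ae_restrict_iff' measurableSet_Ici).1 hu.2

theorem IsCaratheodoryField.measurable_comp {E V : Type*} [NormedAddCommGroup E] [ProperSpace E]
    [MeasurableSpace E] [BorelSpace E] [TopologicalSpace V] [TopologicalSpace.MetrizableSpace V]
    [SecondCountableTopology V] [MeasurableSpace V] [BorelSpace V] {U : ℝ → Set V}
    {a : ℝ → E → V → E} (ha : IsCaratheodoryField U a) {Y : ℝ → E}
    (hY : Measurable Y) {u : ℝ → V} (hu : Measurable u) :
    Measurable fun t => a t (Y t) (u t) := by
  have h := measurable_uncurry_of_continuous_of_measurable (u := fun (p : E × V) t => a t p.1 p.2)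
    ha.continuous (fun p => ha.measurable p.1 p.2)
  exact h.comp ((hY.prodMk hu).prodMk measurable_id)

theorem monotoneOn_primitive {g : ℝ → ℝ} {T : ℝ} (hg : IntegrableOn g (Icc 0 T))
    (hg0 : ∀ᵐ t, t ∈ Icc 0 T → 0 ≤ g t) :
    MonotoneOn (fun t => ∫ r in (0:ℝ)..t, g r) (Icc 0 T) := by
  intro s hs t ht hst
  refine integral_mono_interval le_rfl hs.1 hst ?_ ?_
  · refine (ae_restrict_iff' measurableSet_Ioc).2 ?_
    filter_upwards [hg0] with r hr hrI
    exact hr ⟨hrI.1.le, hrI.2.trans ht.2⟩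
  · exact intervalIntegrable_iff.2 (hg.mono_set fun r hr => by
      rw [uIoc_of_le ht.1] at hr
      exact ⟨hr.1.le, hr.2.trans ht.2⟩)

theorem continuousOn_primitive {g : ℝ → ℝ} {T : ℝ} (hT : 0 ≤ T) (hg : IntegrableOn g (Icc 0 T)) :
    ContinuousOn (fun t => ∫ r in (0:ℝ)..t, g r) (Icc 0 T) := by
  have := continuousOn_primitive_interval (a := (0:ℝ)) (b := T) (μ := volume) (f := g)
    (by rwa [uIcc_of_le hT])
  rwa [uIcc_of_le hT] at this

section Trajectories

variable {E V : Type*} [NormedAddCommGroup E] [ProperSpace E]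
  [MeasurableSpace E] [BorelSpace E]
  [TopologicalSpace V] [TopologicalSpace.MetrizableSpace V] [SecondCountableTopology V]
  [MeasurableSpace V] [BorelSpace V] {U : ℝ → Set V} {a : ℝ → E → V → E}

theorem IsCaratheodoryField.intervalIntegrable (ha : IsCaratheodoryField U a) {Y : ℝ → E}
    (hY : ContinuousOn Y (Ici 0)) {u : ℝ → V} (hu : IsAdmissible U u) {s t : ℝ}
    (hs : 0 ≤ s) (ht : 0 ≤ t) :
    IntervalIntegrable (fun r => a r (Y r) (u r)) volume s t := by
  set T := max s t
  have hYc : Continuous fun r => Y (max r 0) :=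
    hY.comp_continuous (by fun_prop) (fun r => le_max_right r 0)
  obtain ⟨R, hR⟩ := (isCompact_Icc (a := (0:ℝ)) (b := T)).exists_bound_of_continuousOn
    (hY.mono Icc_subset_Ici_self)
  obtain ⟨M, hM, hMb⟩ := ha.majorant R
  have hint : IntegrableOn (fun r => a r (Y (max r 0)) (u r)) (Icc 0 T) := by
    refine Integrable.mono' (hM T)
      (ha.measurable_comp hYc.measurable hu.1).aestronglyMeasurable ?_
    refine (ae_restrict_iff' measurableSet_Icc).2 ?_
    filter_upwards [hu.ae_mem] with r hr hrI
    rw [max_eq_left hrI.1]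
    exact hMb r hrI.1 _ (hr hrI.1) _ (hR r hrI)
  have hint' : IntegrableOn (fun r => a r (Y r) (u r)) (Icc 0 T) := by
    refine hint.congr_fun (fun r hr => ?_) measurableSet_Icc
    simp only [max_eq_left hr.1]
  have h1 : uIoc s t ⊆ Icc 0 T := fun r hr =>
    ⟨(le_min hs ht).trans hr.1.le, hr.2⟩
  exact intervalIntegrable_iff.2 (hint'.mono_set h1)

variable [NormedSpace ℝ E]

theorem IsTrajectory.of_anchor (ha : IsCaratheodoryField U a) {u : ℝ → V}
    (hu : IsAdmissible U u) {Y : ℝ → E} (hY : ContinuousOn Y (Ici 0)) {t₀ : ℝ} (ht₀ : 0 ≤ t₀)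
    {y : E} (h : ∀ t ≥ (0:ℝ), Y t = y + ∫ s in t₀..t, a s (Y s) (u s)) :
    IsTrajectory a u Y := by
  refine ⟨hY, fun s hs t ht => ?_⟩
  rw [h t ht, h s hs, add_sub_add_left_eq_sub]
  exact integral_interval_sub_left (ha.intervalIntegrable hY hu ht₀ ht)
    (ha.intervalIntegrable hY hu ht₀ hs)

/-- The increment of the difference of two trajectories over `[s, t]`. -/
theorem norm_sub_sub_le (ha : IsCaratheodoryField U a) {u u₀ : ℝ → V}
    (hu : IsAdmissible U u) (hu₀ : IsAdmissible U u₀) {Y Z : ℝ → E}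
    (hY : IsTrajectory a u Y) (hZ : IsTrajectory a u₀ Z) {R : ℝ} {L f : ℝ → ℝ}
    (hL0 : ∀ t, 0 ≤ L t) (hL : ∀ T : ℝ, IntegrableOn L (Icc 0 T))
    (hLip : ∀ t ≥ (0:ℝ), ∀ v ∈ U t, ∀ y₁ y₂ : E, ‖y₁‖ ≤ R + 1 → ‖y₂‖ ≤ R + 1 →
      ‖a t y₁ v - a t y₂ v‖ ≤ L t * ‖y₁ - y₂‖)
    {α β : ℝ} (hα : 0 ≤ α) (hZR : ∀ t ∈ Icc α β, ‖Z t‖ ≤ R)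
    (hf : IntegrableOn f (Icc 0 β))
    (hdev : ∀ᵐ t, t ∈ Ioc α β → ‖a t (Z t) (u t) - a t (Z t) (u₀ t)‖ ≤ f t)
    {s t : ℝ} (hs : s ∈ Icc α β) (ht : t ∈ Icc s β) {M : ℝ} (hM : M ≤ 1)
    (hYZ : ∀ r ∈ Icc s t, ‖Y r - Z r‖ ≤ M) :
    ‖(Y t - Z t) - (Y s - Z s)‖ ≤
      M * ((∫ r in (0:ℝ)..t, L r) - ∫ r in (0:ℝ)..s, L r) +
        ((∫ r in (0:ℝ)..t, f r) - ∫ r in (0:ℝ)..s, f r) := by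
  have hs0 : 0 ≤ s := hα.trans hs.1
  have ht0 : 0 ≤ t := hs0.trans ht.1
  have hsub : ∀ {g : ℝ → ℝ}, IntegrableOn g (Icc 0 β) → ∀ {p q : ℝ}, p ∈ Icc 0 β → q ∈ Icc 0 β →
      IntervalIntegrable g volume p q := fun hg p q hp hq =>
    intervalIntegrable_iff.2 (hg.mono_set fun r hr =>
      ⟨(le_min hp.1 hq.1).trans hr.1.le, hr.2.trans (max_le hp.2 hq.2)⟩)
  have m0 : (0:ℝ) ∈ Icc 0 β := ⟨le_rfl, ht0.trans ht.2⟩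
  have ms : s ∈ Icc 0 β := ⟨hs0, hs.2⟩
  have mt : t ∈ Icc 0 β := ⟨ht0, ht.2⟩
  rw [integral_interval_sub_left (hsub (hL β) m0 mt) (hsub (hL β) m0 ms),
    integral_interval_sub_left (hsub hf m0 mt) (hsub hf m0 ms),
    ← intervalIntegral.integral_const_mul,
    ← intervalIntegral.integral_add ((hsub (hL β) ms mt).const_mul M) (hsub hf ms mt),
    show (Y t - Z t) - (Y s - Z s) = (Y t - Y s) - (Z t - Z s) by abel,
    hY.2 s hs0 t ht0, hZ.2 s hs0 t ht0,
    ← intervalIntegral.integral_sub (ha.intervalIntegrable hY.1 hu hs0 ht0)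
      (ha.intervalIntegrable hZ.1 hu₀ hs0 ht0)]
  refine norm_integral_le_of_norm_le ht.1 ?_
    (((hsub (hL β) ms mt).const_mul M).add (hsub hf ms mt))
  filter_upwards [hu.ae_mem, hdev] with r hru hrd hr
  have hr0 : 0 ≤ r := hs0.trans hr.1.le
  have hrst : r ∈ Icc s t := ⟨hr.1.le, hr.2⟩
  have hZr : ‖Z r‖ ≤ R := hZR r ⟨hs.1.trans hr.1.le, hr.2.trans ht.2⟩
  have hd := hYZ r hrst
  have hYr : ‖Y r‖ ≤ R + 1 := by
    have := norm_le_norm_add_norm_sub' (Y r) (Z r)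
    linarith
  have h1 := hLip r hr0 _ (hru hr0) (Y r) (Z r) hYr (by linarith)
  have h2 := hrd ⟨lt_of_le_of_lt hs.1 hr.1, hr.2.trans ht.2⟩
  have h3 := norm_sub_le_norm_sub_add_norm_sub (a r (Y r) (u r)) (a r (Z r) (u r))
    (a r (Z r) (u₀ r))
  have h4 := mul_le_mul_of_nonneg_left hd (hL0 r)
  linarith

/-- Forward comparison of a trajectory for `u` with a bounded trajectory for `u₀`. -/
theorem norm_sub_le_forward (ha : IsCaratheodoryField U a) {u u₀ : ℝ → V}
    (hu : IsAdmissible U u) (hu₀ : IsAdmissible U u₀) {Y Z : ℝ → E}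
    (hY : IsTrajectory a u Y) (hZ : IsTrajectory a u₀ Z) {R : ℝ} {L f : ℝ → ℝ}
    (hL0 : ∀ t, 0 ≤ L t) (hL : ∀ T : ℝ, IntegrableOn L (Icc 0 T))
    (hLip : ∀ t ≥ (0:ℝ), ∀ v ∈ U t, ∀ y₁ y₂ : E, ‖y₁‖ ≤ R + 1 → ‖y₂‖ ≤ R + 1 →
      ‖a t y₁ v - a t y₂ v‖ ≤ L t * ‖y₁ - y₂‖)
    {α β Λ : ℝ} (hα : 0 ≤ α) (hαβ : α ≤ β) (hZR : ∀ t ∈ Icc α β, ‖Z t‖ ≤ R)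
    (hΛ : ∫ r in (0:ℝ)..β, L r ≤ Λ)
    (hf : IntegrableOn f (Icc 0 β)) (hf0 : ∀ t, 0 ≤ f t)
    (hdev : ∀ᵐ t, t ∈ Ioc α β → ‖a t (Z t) (u t) - a t (Z t) (u₀ t)‖ ≤ f t)
    (hsmall : (‖Y α - Z α‖ + ∫ r in α..β, f r) * Real.exp (2 * Λ) < 1) :
    ∀ t ∈ Icc α β, ‖Y t - Z t‖ ≤ (‖Y α - Z α‖ + ∫ r in α..β, f r) * Real.exp (2 * Λ) := by
  have hsubI : Icc α β ⊆ Icc 0 β := Icc_subset_Icc_left hα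
  have hsubI' : Icc α β ⊆ Ici 0 := hsubI.trans Icc_subset_Ici_self
  have hβ : 0 ≤ β := hα.trans hαβ
  have hmL := monotoneOn_primitive (hL β) (.of_forall fun t _ => hL0 t)
  have hmf := monotoneOn_primitive hf (.of_forall fun t _ => hf0 t)
  have hii : ∀ {x : ℝ}, x ∈ Icc 0 β → IntervalIntegrable f volume 0 x := fun hx =>
    intervalIntegrable_iff.2 (hf.mono_set fun r hr => by
      rw [uIoc_of_le hx.1] at hr
      exact ⟨hr.1.le, hr.2.trans hx.2⟩)
  have hfint : (∫ r in (0:ℝ)..β, f r) - ∫ r in (0:ℝ)..α, f r = ∫ r in α..β, f r :=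
    integral_interval_sub_left (hii ⟨hβ, le_rfl⟩) (hii ⟨hα, hαβ⟩)
  have hLα : 0 ≤ ∫ r in (0:ℝ)..α, L r := integral_nonneg hα fun t _ => hL0 t
  have hfαβ : 0 ≤ ∫ r in α..β, f r := integral_nonneg hαβ fun t _ => hf0 t
  have key := le_exp_of_local_bound (φ := fun t => ‖Y t - Z t‖)
    (ℓ := fun t => ∫ r in (0:ℝ)..t, L r) (m := fun t => ∫ r in (0:ℝ)..t, f r)
    (a := α) (b := β) (c := ‖Y α - Z α‖)
    ((hY.1.mono hsubI').sub (hZ.1.mono hsubI')).norm (fun t _ => norm_nonneg _)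
    ((continuousOn_primitive hβ (hL β)).mono hsubI) (hmL.mono hsubI)
    ((continuousOn_primitive hβ hf).mono hsubI) (hmf.mono hsubI)
    (fun s hs t ht M hM hr => by
      have h1 := norm_sub_sub_le ha hu hu₀ hY hZ hL0 hL hLip hα hZR hf hdev hs ht hM hr
      have h2 := norm_le_norm_add_norm_sub' (Y t - Z t) (Y s - Z s)
      linarith)
    le_rfl
    (by
      refine lt_of_le_of_lt ?_ hsmall
      simp only [hfint]
      gcongr
      linarith)
  intro t ht
  refine (key t ht).trans ?_
  have h1 := hmf (hsubI ht) ⟨hβ, le_rfl⟩ ht.2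
  have h2 := hmL (hsubI ht) ⟨hβ, le_rfl⟩ ht.2
  have h3 := hmf ⟨hα, hαβ⟩ (hsubI ht) ht.1
  simp only at h1 h2 h3 ⊢
  gcongr
  · linarith
  · linarith

/-- Backward comparison of two trajectories for the same control. -/
theorem norm_sub_le_backward (ha : IsCaratheodoryField U a) {u₀ : ℝ → V}
    (hu₀ : IsAdmissible U u₀) {Y Z : ℝ → E}
    (hY : IsTrajectory a u₀ Y) (hZ : IsTrajectory a u₀ Z) {R : ℝ} {L : ℝ → ℝ}
    (hL0 : ∀ t, 0 ≤ L t) (hL : ∀ T : ℝ, IntegrableOn L (Icc 0 T))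
    (hLip : ∀ t ≥ (0:ℝ), ∀ v ∈ U t, ∀ y₁ y₂ : E, ‖y₁‖ ≤ R + 1 → ‖y₂‖ ≤ R + 1 →
      ‖a t y₁ v - a t y₂ v‖ ≤ L t * ‖y₁ - y₂‖)
    {β Λ : ℝ} (hβ : 0 ≤ β) (hZR : ∀ t ∈ Icc 0 β, ‖Z t‖ ≤ R)
    (hΛ : ∫ r in (0:ℝ)..β, L r ≤ Λ)
    (hsmall : ‖Y β - Z β‖ * Real.exp (2 * Λ) < 1) :
    ∀ t ∈ Icc 0 β, ‖Y t - Z t‖ ≤ ‖Y β - Z β‖ * Real.exp (2 * Λ) := by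
  have hmL := monotoneOn_primitive (hL β) (.of_forall fun t _ => hL0 t)
  have key := le_exp_of_local_bound_backward (φ := fun t => ‖Y t - Z t‖)
    (ℓ := fun t => ∫ r in (0:ℝ)..t, L r)
    (a := 0) (b := β) (c := ‖Y β - Z β‖)
    ((hY.1.mono Icc_subset_Ici_self).sub (hZ.1.mono Icc_subset_Ici_self)).norm
    (fun t _ => norm_nonneg _)
    (continuousOn_primitive hβ (hL β)) hmL
    (fun s hs t ht M hM hr => by
      have h1 := norm_sub_sub_le ha hu₀ hu₀ hY hZ hL0 hL hLip le_rfl hZR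
        (f := fun _ => 0) integrableOn_zero (by simp) hs ht hM hr
      have h2 := norm_le_norm_add_norm_sub (Y t - Z t) (Y s - Z s)
      simp only [intervalIntegral.integral_zero, sub_zero, add_zero] at h1
      linarith)
    le_rfl
    (by
      refine lt_of_le_of_lt ?_ hsmall
      simp only [integral_same, sub_zero]
      gcongr)
  intro t ht
  refine (key t ht).trans ?_
  have h2 : 0 ≤ ∫ r in (0:ℝ)..t, L r := integral_nonneg ht.1 fun t _ => hL0 t
  gcongr
  linarith

/-- Trajectories for the same control with the same initial value coincide on `[0,∞)`. -/
theorem IsTrajectory.eq_of_eq_zero (ha : IsCaratheodoryField U a) {u₀ : ℝ → V}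
    (hu₀ : IsAdmissible U u₀) {Y Z : ℝ → E}
    (hY : IsTrajectory a u₀ Y) (hZ : IsTrajectory a u₀ Z) (h0 : Y 0 = Z 0) {t : ℝ} (ht : 0 ≤ t) :
    Y t = Z t := by
  obtain ⟨R, hR⟩ := (isCompact_Icc (a := (0:ℝ)) (b := t)).exists_bound_of_continuousOn
    (hZ.1.mono Icc_subset_Ici_self)
  obtain ⟨L, hL0, hL, hLip⟩ := ha.lipschitz (R + 1)
  have := norm_sub_le_forward ha hu₀ hu₀ hY hZ hL0 hL hLip le_rfl ht hR le_rfl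
    (f := fun _ => 0) integrableOn_zero (fun _ => le_rfl) (by simp) (by simp [h0]) t ⟨ht, le_rfl⟩
  simpa [h0, sub_eq_zero] using this

/-- Trajectories issuing from a compact set are uniformly bounded on compact time intervals. -/
theorem exists_bound_of_isCompact (ha : IsCaratheodoryField U a) {u₀ : ℝ → V}
    (hu₀ : IsAdmissible U u₀) {S : E → ℝ → E} (hS : ∀ ξ, IsTrajectory a u₀ (S ξ))
    (hS0 : ∀ ξ, S ξ 0 = ξ) {K : Set E} (hK : IsCompact K) {T : ℝ} (hT : 0 ≤ T) :
    ∃ R, 0 ≤ R ∧ ∀ ξ ∈ K, ∀ t ∈ Icc 0 T, ‖S ξ t‖ ≤ R := by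
  refine hK.induction_on (p := fun K => ∃ R, 0 ≤ R ∧ ∀ ξ ∈ K, ∀ t ∈ Icc 0 T, ‖S ξ t‖ ≤ R)
    ⟨0, le_rfl, by simp⟩ ?_ ?_ ?_
  · rintro s t hst ⟨R, hR0, hR⟩
    exact ⟨R, hR0, fun ξ hξ => hR ξ (hst hξ)⟩
  · rintro s t ⟨R, hR0, hR⟩ ⟨R', -, hR'⟩
    refine ⟨max R R', hR0.trans (le_max_left _ _), fun ξ hξ r hr => ?_⟩
    rcases hξ with hξ | hξ
    · exact (hR ξ hξ r hr).trans (le_max_left _ _)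
    · exact (hR' ξ hξ r hr).trans (le_max_right _ _)
  · intro ξ _
    obtain ⟨R, hR⟩ := (isCompact_Icc (a := (0:ℝ)) (b := T)).exists_bound_of_continuousOn
      ((hS ξ).1.mono Icc_subset_Ici_self)
    have hR0 : 0 ≤ R := (norm_nonneg _).trans (hR 0 ⟨le_rfl, hT⟩)
    obtain ⟨L, hL0, hL, hLip⟩ := ha.lipschitz (R + 1)
    set Λ := ∫ r in (0:ℝ)..T, L r with hΛ
    refine ⟨Metric.ball ξ (Real.exp (2 * Λ))⁻¹, mem_nhdsWithin_of_mem_nhds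
      (Metric.ball_mem_nhds _ (by positivity)), R + 1, by linarith, fun ζ hζ t ht => ?_⟩
    have hsm : ‖ζ - ξ‖ * Real.exp (2 * Λ) < 1 := by
      rw [Metric.mem_ball, dist_eq_norm] at hζ
      have := mul_lt_mul_of_pos_right hζ (Real.exp_pos (2 * Λ))
      rwa [inv_mul_cancel₀ (Real.exp_pos _).ne'] at this
    have h := norm_sub_le_forward ha hu₀ hu₀ (hS ζ) (hS ξ) hL0 hL hLip le_rfl hT hR hΛ.symm.le
      (f := fun _ => 0) integrableOn_zero (fun _ => le_rfl) (by simp)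
      (by simpa [hS0] using hsm) t ht
    simp only [hS0, intervalIntegral.integral_zero, add_zero] at h
    have h2 := norm_le_norm_add_norm_sub' (S ζ t) (S ξ t)
    have h3 := hR t ht
    linarith

end Trajectories

/-- Largest effect over the ball of radius `R` of replacing the control value `u₀ t` by `v`. -/
noncomputable def deviation {E V : Type*} [NormedAddCommGroup E] (a : ℝ → E → V → E)
    (u₀ : ℝ → V) (R t : ℝ) (v : V) : ℝ :=
  sSup ((fun y => ‖a t y v - a t y (u₀ t)‖) '' Metric.closedBall 0 R)

theorem deviation_nonneg {E V : Type*} [NormedAddCommGroup E] (a : ℝ → E → V → E)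
    (u₀ : ℝ → V) (R t : ℝ) (v : V) : 0 ≤ deviation a u₀ R t v :=
  Real.sSup_nonneg (by rintro _ ⟨y, -, rfl⟩; exact norm_nonneg _)

theorem deviation_self {E V : Type*} [NormedAddCommGroup E] (a : ℝ → E → V → E)
    (u₀ : ℝ → V) (R t : ℝ) : deviation a u₀ R t (u₀ t) = 0 :=
  le_antisymm (Real.sSup_le (by rintro _ ⟨y, -, rfl⟩; simp) le_rfl) (deviation_nonneg ..)

section Deviation

variable {E V : Type*} [NormedAddCommGroup E] [MeasurableSpace E]
  [TopologicalSpace V] {U : ℝ → Set V} {a : ℝ → E → V → E}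

theorem IsCaratheodoryField.continuous_norm_sub (ha : IsCaratheodoryField U a) (u₀ : ℝ → V)
    (t : ℝ) : Continuous fun p : V × E => ‖a t p.2 p.1 - a t p.2 (u₀ t)‖ := by
  have h1 := (ha.continuous t).comp (continuous_snd.prodMk continuous_fst : Continuous
    fun p : V × E => (p.2, p.1))
  have h2 := (ha.continuous t).comp (continuous_snd.prodMk continuous_const : Continuous
    fun p : V × E => (p.2, u₀ t))
  exact (h1.sub h2).norm

variable [ProperSpace E]

theorem bddAbove_deviation (ha : IsCaratheodoryField U a) (u₀ : ℝ → V) (R t : ℝ) (v : V) :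
    BddAbove ((fun y => ‖a t y v - a t y (u₀ t)‖) '' Metric.closedBall 0 R) :=
  (isCompact_closedBall 0 R).bddAbove_image
    ((ha.continuous_norm_sub u₀ t).comp (by fun_prop : Continuous fun y : E => (v, y))).continuousOn

theorem le_deviation (ha : IsCaratheodoryField U a) (u₀ : ℝ → V) {R : ℝ} (t : ℝ) (v : V) {y : E}
    (hy : ‖y‖ ≤ R) : ‖a t y v - a t y (u₀ t)‖ ≤ deviation a u₀ R t v :=
  le_csSup (bddAbove_deviation ha u₀ R t v) ⟨y, by simpa using hy, rfl⟩

theorem continuous_deviation (ha : IsCaratheodoryField U a) (u₀ : ℝ → V) (R t : ℝ) :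
    Continuous (deviation a u₀ R t) :=
  (isCompact_closedBall 0 R).continuous_sSup (ha.continuous_norm_sub u₀ t)

variable [BorelSpace E] [TopologicalSpace.MetrizableSpace V] [SecondCountableTopology V]
  [MeasurableSpace V] [BorelSpace V]

theorem measurable_deviation (ha : IsCaratheodoryField U a) {u₀ : ℝ → V} (hu₀ : Measurable u₀)
    {R : ℝ} (hR : 0 ≤ R) (v : V) : Measurable fun t => deviation a u₀ R t v := by
  have hne : (Metric.closedBall (0:E) R).Nonempty := ⟨0, by simpa using hR⟩
  have : Nonempty (Metric.closedBall (0:E) R) := hne.to_subtype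
  set d := TopologicalSpace.denseSeq (Metric.closedBall (0:E) R)
  have hd : DenseRange d := TopologicalSpace.denseRange_denseSeq _
  refine measurable_of_Iic fun c => ?_
  have heq : (fun t => deviation a u₀ R t v) ⁻¹' Iic c =
      ⋂ i, {t | ‖a t (d i) v - a t (d i) (u₀ t)‖ ≤ c} := by
    ext t
    simp only [mem_preimage, mem_Iic, mem_iInter, mem_ofPred_eq, deviation]
    rw [csSup_le_iff (bddAbove_deviation ha u₀ R t v) (hne.image _), forall_mem_image]
    refine ⟨fun h i => h (d i).2, fun h y hy => ?_⟩
    have hc : Continuous fun y : Metric.closedBall (0:E) R => ‖a t y v - a t y (u₀ t)‖ :=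
      (ha.continuous_norm_sub u₀ t).comp (by fun_prop : Continuous
        fun y : Metric.closedBall (0:E) R => (v, (y : E)))
    exact hd.induction_on (p := fun y : Metric.closedBall (0:E) R =>
      ‖a t y v - a t y (u₀ t)‖ ≤ c) ⟨y, hy⟩ (isClosed_le hc continuous_const) h
  rw [heq]
  refine MeasurableSet.iInter fun i => measurableSet_le ?_ measurable_const
  exact ((ha.measurable _ v).sub (ha.measurable_comp measurable_const hu₀)).norm

theorem integrableOn_deviation (ha : IsCaratheodoryField U a) {u₀ u : ℝ → V}
    (hu₀ : IsAdmissible U u₀) (hu : IsAdmissible U u) {R : ℝ} (hR : 0 ≤ R) (T : ℝ) :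
    IntegrableOn (fun r => deviation a u₀ R r (u r)) (Icc 0 T) := by
  obtain ⟨M, hM, hMb⟩ := ha.majorant R
  have hmeas : Measurable fun r => deviation a u₀ R r (u r) :=
    (measurable_uncurry_of_continuous_of_measurable (u := fun v t => deviation a u₀ R t v)
      (continuous_deviation ha u₀ R) (measurable_deviation ha hu₀.1 hR)).comp
      (hu.1.prodMk measurable_id)
  refine Integrable.mono' ((hM T).const_mul 2) hmeas.aestronglyMeasurable ?_
  refine (ae_restrict_iff' measurableSet_Icc).2 ?_
  filter_upwards [hu.ae_mem, hu₀.ae_mem] with r hr hr₀ hrI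
  rw [Real.norm_of_nonneg (deviation_nonneg ..)]
  have hne : (Metric.closedBall (0:E) R).Nonempty := ⟨0, by simpa using hR⟩
  refine csSup_le (hne.image _) ?_
  rintro _ ⟨y, hy, rfl⟩
  have hy' : ‖y‖ ≤ R := by simpa using hy
  have h1 := hMb r hrI.1 _ (hr hrI.1) y hy'
  have h2 := hMb r hrI.1 _ (hr₀ hrI.1) y hy'
  have h3 := norm_sub_le (a r y (u r)) (a r y (u₀ r))
  simp only
  linarith

/-- Displacement of the pulled-back initial value between the times `α` and `t`. -/
theorem norm_pullback_sub_le [NormedSpace ℝ E] (ha : IsCaratheodoryField U a) {u₀ u : ℝ → V}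
    (hu₀ : IsAdmissible U u₀) (hu : IsAdmissible U u) {S : E → ℝ → E}
    (hS : ∀ ξ, IsTrajectory a u₀ (S ξ)) (hS0 : ∀ ξ, S ξ 0 = ξ) {Y : ℝ → E}
    (hY : IsTrajectory a u Y) {R : ℝ} {L : ℝ → ℝ}
    (hL0 : ∀ t, 0 ≤ L t) (hL : ∀ T : ℝ, IntegrableOn L (Icc 0 T))
    (hLip : ∀ t ≥ (0:ℝ), ∀ v ∈ U t, ∀ y₁ y₂ : E, ‖y₁‖ ≤ R + 1 → ‖y₂‖ ≤ R + 1 →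
      ‖a t y₁ v - a t y₂ v‖ ≤ L t * ‖y₁ - y₂‖)
    {α t Λ : ℝ} (hα : 0 ≤ α) (hαt : α ≤ t) (hR : 0 ≤ R) {x x' : E}
    (hxR : ∀ s ∈ Icc 0 t, ‖S x s‖ ≤ R) (hΛ : ∫ r in (0:ℝ)..t, L r ≤ Λ)
    (hx : S x α = Y α) (hx' : S x' t = Y t)
    (hlt : Real.exp (4 * Λ) * (∫ s in α..t, deviation a u₀ R s (u s)) < 1) :
    ‖x' - x‖ ≤ Real.exp (4 * Λ) * ∫ s in α..t, deviation a u₀ R s (u s) := by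
  have ht0 : 0 ≤ t := hα.trans hαt
  have hΛ0 : 0 ≤ Λ := (integral_nonneg ht0 fun s _ => hL0 s).trans hΛ
  have hfwd := norm_sub_le_forward ha hu hu₀ hY (hS x) hL0 hL hLip hα hαt
    (fun s hs => hxR s ⟨hα.trans hs.1, hs.2⟩) hΛ
    (integrableOn_deviation ha hu₀ hu hR t) (fun s => deviation_nonneg ..)
    (.of_forall fun s hs => le_deviation ha u₀ s (u s) (hxR s ⟨hα.trans hs.1.le, hs.2⟩))
  have hI0 : 0 ≤ ∫ s in α..t, deviation a u₀ R s (u s) :=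
    integral_nonneg hαt fun s _ => deviation_nonneg ..
  rw [hx, sub_self, norm_zero, zero_add] at hfwd
  generalize (∫ s in α..t, deviation a u₀ R s (u s)) = I at hfwd hI0 hlt ⊢
  have hexp : I * Real.exp (2 * Λ) * Real.exp (2 * Λ) = Real.exp (4 * Λ) * I := by
    rw [mul_assoc, ← Real.exp_add, mul_comm]
    ring_nf
  have he1 : 1 ≤ Real.exp (2 * Λ) := Real.one_le_exp (by linarith)
  have hfwd' := hfwd ((le_mul_of_one_le_right (by positivity) he1).trans_lt (hexp ▸ hlt)) t
    ⟨hαt, le_rfl⟩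
  have hmul : ‖S x' t - S x t‖ * Real.exp (2 * Λ) ≤ Real.exp (4 * Λ) * I := by
    rw [hx', ← hexp]
    gcongr
  have hbwd := norm_sub_le_backward ha hu₀ (hS x') (hS x) hL0 hL hLip ht0
    hxR hΛ (hmul.trans_lt hlt) 0 ⟨le_rfl, ht0⟩
  rw [hS0, hS0] at hbwd
  exact hbwd.trans hmul

/-- There is a Carathéodory weight, vanishing along `u₀`, whose integral along a control `u`
bounds the displacement of the initial values obtained by pulling a trajectory for `u` back
along the flow of `u₀`. -/
theorem exists_weight_pullback [NormedSpace ℝ E] (ha : IsCaratheodoryField U a) {u₀ : ℝ → V}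
    (hu₀ : IsAdmissible U u₀) {S : E → ℝ → E} (hS : ∀ ξ, IsTrajectory a u₀ (S ξ))
    (hS0 : ∀ ξ, S ξ 0 = ξ) {K : Set E} (hK : IsCompact K) :
    ∃ w : ℝ → V → ℝ, (∀ v, Measurable fun t => w t v) ∧ (∀ t, Continuous fun v => w t v) ∧
      (∀ t v, 0 ≤ w t v) ∧ (∀ t, w t (u₀ t) = 0) ∧
      ∀ ξ, Metric.closedBall ξ 1 ⊆ K → ∀ u, IsAdmissible U u → ∀ Y, IsTrajectory a u Y →
        ∀ z : ℝ → E, z 0 = ξ → (∀ t ≥ (0:ℝ), S (z t) t = Y t) →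
        (∀ t ≥ (0:ℝ), ∫ s in (0:ℝ)..t, w s (u s) < 1) →
        ∀ t ≥ (0:ℝ), ‖z t - ξ‖ ≤ ∫ s in (0:ℝ)..t, w s (u s) := by
  choose R hR0 hR using fun n : ℕ =>
    exists_bound_of_isCompact ha hu₀ hS hS0 hK (T := n + 1) (by positivity)
  choose L hL0 hL hLip using fun n => ha.lipschitz (R n + 1)
  obtain ⟨Λ, hΛ⟩ : ∃ Λ : ℕ → ℝ, ∀ n : ℕ, ∫ r in (0:ℝ)..(n + 1), L n r = Λ n := ⟨_, fun _ => rfl⟩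
  obtain ⟨W, hW⟩ : ∃ W : ℕ → ℝ → V → ℝ, ∀ n t v,
      W n t v = Real.exp (4 * Λ n) * deviation a u₀ (R n) t v := ⟨_, fun _ _ _ => rfl⟩
  have hW0 : ∀ n t v, 0 ≤ W n t v := fun n t v => by
    rw [hW]
    exact mul_nonneg (Real.exp_pos _).le (deviation_nonneg ..)
  have hwmeas : ∀ v, Measurable fun t => W ⌊t⌋₊ t v := by
    intro v
    have hWv : Measurable fun p : ℕ × ℝ => W p.1 p.2 v := by
      refine measurable_from_prod_countable_right fun n => ?_
      simp only [hW]
      exact (measurable_deviation ha hu₀.1 (hR0 n) v).const_mul _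
    have hfl : Measurable fun t : ℝ => (⌊t⌋₊, t) := Nat.measurable_floor.prodMk measurable_id
    exact hWv.comp hfl
  have hwcont : ∀ t, Continuous fun v => W ⌊t⌋₊ t v := by
    intro t
    simp only [hW]
    exact (continuous_deviation ha u₀ _ t).const_mul _
  refine ⟨fun t v => W ⌊t⌋₊ t v, hwmeas, hwcont, fun t v => hW0 _ t v,
    fun t => by simp [hW, deviation_self], ?_⟩
  intro ξ hξK u hu Y hY z hz0 hzS hlt
  have hWint : ∀ n T, IntegrableOn (fun r => W n r (u r)) (Icc 0 T) := by
    intro n T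
    simp only [hW]
    exact (integrableOn_deviation ha hu₀ hu (hR0 n) T).const_mul _
  have hwint : ∀ T, IntegrableOn (fun r => W ⌊r⌋₊ r (u r)) (Icc 0 T) := by
    intro T
    have hmeas : Measurable fun r => W ⌊r⌋₊ r (u r) :=
      (measurable_uncurry_of_continuous_of_measurable (u := fun v t => W ⌊t⌋₊ t v)
        hwcont hwmeas).comp (hu.1.prodMk measurable_id)
    refine Integrable.mono' (integrable_finsetSum (Finset.range (⌊T⌋₊ + 1))
      fun n _ => hWint n T) hmeas.aestronglyMeasurable ?_
    refine (ae_restrict_iff' measurableSet_Icc).2 (.of_forall fun r hr => ?_)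
    rw [Real.norm_of_nonneg (hW0 ..)]
    exact Finset.single_le_sum (f := fun n => W n r (u r)) (fun n _ => hW0 n r (u r))
      (Finset.mem_range.2 (Nat.lt_succ_of_le (Nat.floor_le_floor hr.2)))
  have hwii : ∀ {p q : ℝ}, 0 ≤ p → 0 ≤ q →
      IntervalIntegrable (fun r => W ⌊r⌋₊ r (u r)) volume p q := fun {p q} hp hq =>
    intervalIntegrable_iff.2 ((hwint (max p q)).mono_set fun r hr =>
      ⟨(le_min hp hq).trans hr.1.le, hr.2⟩)
  have step : ∀ n : ℕ, ‖z n - ξ‖ ≤ (∫ s in (0:ℝ)..n, W ⌊s⌋₊ s (u s)) →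
      ∀ t ∈ Icc (n:ℝ) (n + 1), ‖z t - ξ‖ ≤ ∫ s in (0:ℝ)..t, W ⌊s⌋₊ s (u s) := by
    intro n hn t ht
    have hn0 : (0:ℝ) ≤ n := n.cast_nonneg
    have ht0 : 0 ≤ t := hn0.trans ht.1
    have hznK : z n ∈ K := hξK (by
      rw [Metric.mem_closedBall, dist_eq_norm]
      exact hn.trans (hlt n hn0).le)
    have hZR : ∀ s ∈ Icc 0 t, ‖S (z n) s‖ ≤ R n := fun s hs =>
      hR n (z n) hznK s ⟨hs.1, hs.2.trans ht.2⟩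
    have hsplit : (∫ s in (0:ℝ)..t, W ⌊s⌋₊ s (u s)) =
        (∫ s in (0:ℝ)..n, W ⌊s⌋₊ s (u s)) + ∫ s in (n:ℝ)..t, W ⌊s⌋₊ s (u s) :=
      (integral_add_adjacent_intervals (hwii le_rfl hn0) (hwii hn0 ht0)).symm
    have hpiece : (∫ s in (n:ℝ)..t, W ⌊s⌋₊ s (u s)) =
        Real.exp (4 * Λ n) * ∫ s in (n:ℝ)..t, deviation a u₀ (R n) s (u s) := by
      rw [← intervalIntegral.integral_const_mul]
      refine integral_congr_ae ?_
      filter_upwards [compl_mem_ae_iff.2 (measure_singleton ((n:ℝ) + 1))] with s hs hsI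
      rw [uIoc_of_le ht.1] at hsI
      have hfl : ⌊s⌋₊ = n := (Nat.floor_eq_iff (hn0.trans hsI.1.le)).2
        ⟨hsI.1.le, lt_of_le_of_ne (hsI.2.trans ht.2) hs⟩
      rw [hfl, hW]
    have hpre : 0 ≤ ∫ s in (0:ℝ)..n, W ⌊s⌋₊ s (u s) := integral_nonneg hn0 fun s _ => hW0 ..
    have hlt1 : Real.exp (4 * Λ n) * (∫ s in (n:ℝ)..t, deviation a u₀ (R n) s (u s)) < 1 := by
      rw [← hpiece]
      have := hlt t ht0
      linarith
    have hLt : ∫ r in (0:ℝ)..t, L n r ≤ Λ n := by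
      rw [← hΛ]
      exact monotoneOn_primitive (hL n (n + 1)) (.of_forall fun s _ => hL0 n s) ⟨ht0, ht.2⟩
        ⟨by positivity, le_rfl⟩ ht.2
    have hbwd := norm_pullback_sub_le ha hu₀ hu hS hS0 hY (hL0 n) (hL n) (hLip n) hn0 ht.1
      (hR0 n) hZR hLt (hzS n hn0) (hzS t ht0) hlt1
    have htri := norm_sub_le_norm_sub_add_norm_sub (z t) (z n) ξ
    rw [hsplit, hpiece]
    linarith
  have hnat : ∀ n : ℕ, ‖z n - ξ‖ ≤ ∫ s in (0:ℝ)..n, W ⌊s⌋₊ s (u s) := by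
    intro n
    induction n with
    | zero => simp [hz0]
    | succ n ih =>
      have := step n ih (n + 1) ⟨by linarith, le_rfl⟩
      exact_mod_cast this
  intro t ht
  exact step ⌊t⌋₊ (hnat _) t ⟨Nat.floor_le ht, (Nat.lt_floor_add_one t).le⟩

end Deviation

/-- Pointwise stability on a compact set is uniform. -/
theorem exists_uniform_stability {E F : Type*} [NormedAddCommGroup E] [NormedAddCommGroup F]
    {p : E → ℝ → F} {G K : Set E} (hK : IsCompact K) (hKG : K ⊆ G)
    (hstab : ∀ ξ ∈ K, ∀ ε > (0:ℝ), ∃ δ > (0:ℝ), ∀ ξ' ∈ G, ‖ξ' - ξ‖ < δ →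
      ∀ s ≥ (0:ℝ), ‖p ξ' s - p ξ s‖ < ε) {ε : ℝ} (hε : 0 < ε) :
    ∃ δ > (0:ℝ), ∀ ξ ∈ K, ∀ ξ' ∈ G, ‖ξ' - ξ‖ < δ → ∀ s ≥ (0:ℝ), ‖p ξ' s - p ξ s‖ < ε := by
  suffices h : ∃ δ > (0:ℝ), ∀ ξ ∈ K, ξ ∈ G → ∀ ξ' ∈ G, ‖ξ' - ξ‖ < δ →
      ∀ s ≥ (0:ℝ), ‖p ξ' s - p ξ s‖ < ε by
    obtain ⟨δ, hδ, h⟩ := h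
    exact ⟨δ, hδ, fun ξ hξ => h ξ hξ (hKG hξ)⟩
  refine hK.induction_on (p := fun K => ∃ δ > (0:ℝ), ∀ ξ ∈ K, ξ ∈ G → ∀ ξ' ∈ G, ‖ξ' - ξ‖ < δ →
    ∀ s ≥ (0:ℝ), ‖p ξ' s - p ξ s‖ < ε) ⟨1, one_pos, by simp⟩ ?_ ?_ ?_
  · rintro s t hst ⟨δ, hδ, h⟩
    exact ⟨δ, hδ, fun ξ hξ => h ξ (hst hξ)⟩
  · rintro s t ⟨δ, hδ, h⟩ ⟨δ', hδ', h'⟩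
    refine ⟨min δ δ', lt_min hδ hδ', fun ξ hξ hG ξ' hξ' hd => ?_⟩
    rcases hξ with hξ | hξ
    · exact h ξ hξ hG ξ' hξ' (hd.trans_le (min_le_left _ _))
    · exact h' ξ hξ hG ξ' hξ' (hd.trans_le (min_le_right _ _))
  · intro x hx
    obtain ⟨δ, hδ, h⟩ := hstab x hx (ε / 2) (half_pos hε)
    refine ⟨Metric.ball x (δ / 2),
      mem_nhdsWithin_of_mem_nhds (Metric.ball_mem_nhds _ (by positivity)), δ / 2, by positivity, fun ξ hξ hG ξ' hξ' hd s hs => ?_⟩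
    rw [Metric.mem_ball, dist_eq_norm] at hξ
    have h1 := h ξ hG (by linarith) s hs
    have h2 := h ξ' hξ' (by linarith [norm_sub_le_norm_sub_add_norm_sub ξ' ξ x]) s hs
    have h3 := norm_sub_le_norm_sub_add_norm_sub (p ξ' s) (p x s) (p ξ s)
    rw [norm_sub_rev (p x s)] at h3
    linarith

/-- **Proposition `zvez`: stability of the `p`-component under small
perturbations of the control.**  `E = E_p × E_q` is a product of
finite-dimensional Euclidean spaces; `U` is a compact-valued multifunction with
closed Borel graph, bounded on compact time intervals, with measurable
selectors as admissible controls; `a` is a Carathéodory right-hand side,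
locally Lipschitz with locally integrable constants and majorants, whose
solutions extend to all of `[0,∞)`; `sol u ξ` is the solution `y^u_ξ` of
`ẏ = a(t,y,u(t))`, `y(0) = ξ`; `κ(t*,y*)` is the value at time `0` of the
solution through `(t*,y*)` for the control `u⁰`.  If for every `ξ ∈ K₀` the
solution `y^{u⁰}_ξ` has a Lyapunov-stable `p`-component in the closed set
`G₀ ⊇ K₀`, then there is a nonnegative Carathéodory weight `w⁰` vanishing along
`u⁰` such that: for every `ε > 0` there is `δ > 0` with
`sup_{t ≥ 0} ‖p^u_ξ(t) − p^{u⁰}_ξ(t)‖ < ε` for all `ξ ∈ K₀` and all admissible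
`u` that coincide with `u⁰` from some finite time onward, have
`𝓛_{w⁰}[u] < δ`, and whose pulled-back trajectory stays in `G₀`. -/
theorem stability_of_p_component
    {Ep Eq : Type*}
    [NormedAddCommGroup Ep] [InnerProductSpace ℝ Ep] [FiniteDimensional ℝ Ep]
    [MeasurableSpace Ep] [BorelSpace Ep]
    [NormedAddCommGroup Eq] [InnerProductSpace ℝ Eq] [FiniteDimensional ℝ Eq]
    [MeasurableSpace Eq] [BorelSpace Eq]
    (k : ℕ)
    (U : ℝ → Set (Fin k → ℝ))
    (hUne : ∀ t ≥ (0:ℝ), (U t).Nonempty)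
    (hUcomp : ∀ t ≥ (0:ℝ), IsCompact (U t))
    (hUbdd : ∀ T : ℝ, ∃ C : ℝ, ∀ t ∈ Icc (0:ℝ) T, ∀ v ∈ U t, ‖v‖ ≤ C)
    (hUgc : IsClosed {p : ℝ × (Fin k → ℝ) | 0 ≤ p.1 ∧ p.2 ∈ U p.1})
    (hUgm : MeasurableSet {p : ℝ × (Fin k → ℝ) | 0 ≤ p.1 ∧ p.2 ∈ U p.1})
    (Adm : (ℝ → Fin k → ℝ) → Prop)
    (hAdm : ∀ u, Adm u ↔ Measurable u ∧
        ∀ᵐ t ∂(volume.restrict (Ici (0:ℝ))), u t ∈ U t)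
    (a : ℝ → Ep × Eq → (Fin k → ℝ) → Ep × Eq)
    (hameas : ∀ (y : Ep × Eq) (v : Fin k → ℝ), Measurable fun t => a t y v)
    (hacont : ∀ t : ℝ, Continuous fun p : (Ep × Eq) × (Fin k → ℝ) => a t p.1 p.2)
    (haLip : ∀ R : ℝ, ∃ L : ℝ → ℝ, (∀ t, 0 ≤ L t) ∧
        (∀ T : ℝ, IntegrableOn L (Icc 0 T)) ∧
        ∀ t ≥ (0:ℝ), ∀ v ∈ U t, ∀ y₁ y₂ : Ep × Eq, ‖y₁‖ ≤ R → ‖y₂‖ ≤ R →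
          ‖a t y₁ v - a t y₂ v‖ ≤ L t * ‖y₁ - y₂‖)
    (haMaj : ∀ R : ℝ, ∃ Mj : ℝ → ℝ, (∀ T : ℝ, IntegrableOn Mj (Icc 0 T)) ∧
        ∀ t ≥ (0:ℝ), ∀ v ∈ U t, ∀ y : Ep × Eq, ‖y‖ ≤ R → ‖a t y v‖ ≤ Mj t)
    (haExt : ∀ u, Adm u → ∀ tstar ≥ (0:ℝ), ∀ ystar : Ep × Eq, ∃ Y : ℝ → Ep × Eq,
        ContinuousOn Y (Ici 0) ∧ Y tstar = ystar ∧
        ∀ t ≥ (0:ℝ), Y t = ystar + ∫ s in tstar..t, a s (Y s) (u s))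
    (u0 : ℝ → Fin k → ℝ) (hu0 : Adm u0)
    (sol : (ℝ → Fin k → ℝ) → Ep × Eq → ℝ → Ep × Eq)
    (hsol : ∀ u, Adm u → ∀ ξ : Ep × Eq, ContinuousOn (sol u ξ) (Ici 0) ∧
        sol u ξ 0 = ξ ∧
        ∀ t ≥ (0:ℝ), sol u ξ t = ξ + ∫ s in (0:ℝ)..t, a s (sol u ξ s) (u s))
    (κ : ℝ → Ep × Eq → Ep × Eq)
    (hκ : ∀ tstar ≥ (0:ℝ), ∀ ystar : Ep × Eq, ∃ Y : ℝ → Ep × Eq,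
        ContinuousOn Y (Ici 0) ∧ Y tstar = ystar ∧
        (∀ t ≥ (0:ℝ), Y t = ystar + ∫ s in tstar..t, a s (Y s) (u0 s)) ∧
        κ tstar ystar = Y 0)
    (G0 : Set (Ep × Eq)) (hG0 : IsClosed G0)
    (K0 : Set (Ep × Eq)) (hK0 : IsCompact K0) (hK0G0 : K0 ⊆ G0)
    (hstab : ∀ ξ ∈ K0, ∀ ε > (0:ℝ), ∃ δ > (0:ℝ), ∀ ξ' ∈ G0, ‖ξ' - ξ‖ < δ →
        ∀ s ≥ (0:ℝ), ‖(sol u0 ξ' s).1 - (sol u0 ξ s).1‖ < ε) :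
    ∃ w0 : ℝ → (Fin k → ℝ) → ℝ,
      (∀ v : Fin k → ℝ, Measurable fun t => w0 t v) ∧
      (∀ t : ℝ, Continuous fun v => w0 t v) ∧
      (∀ t v, 0 ≤ w0 t v) ∧
      (∀ᵐ t ∂(volume.restrict (Ici (0:ℝ))), w0 t (u0 t) = 0) ∧
      ∀ ε > (0:ℝ), ∃ δ > (0:ℝ), ∀ ξ ∈ K0, ∀ u, Adm u →
        (∃ T ≥ (0:ℝ), ∀ᵐ t ∂(volume.restrict (Ici T)), u t = u0 t) →
        (∀ t ≥ (0:ℝ), (∫ s in (0:ℝ)..t, w0 s (u s)) < δ) →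
        (∀ t ≥ (0:ℝ), κ t (sol u ξ t) ∈ G0) →
        ∃ c < ε, ∀ t ≥ (0:ℝ), ‖(sol u ξ t).1 - (sol u0 ξ t).1‖ ≤ c := by
  have hprop := FiniteDimensional.proper ℝ Ep
  have hpropq := FiniteDimensional.proper ℝ Eq
  have ha : IsCaratheodoryField U a := ⟨hameas, hacont, haLip, haMaj⟩
  have hAdm' : ∀ u, Adm u → IsAdmissible U u := fun u hu => (hAdm u).1 hu
  have htraj : ∀ u, Adm u → ∀ ξ, IsTrajectory a u (sol u ξ) := fun u hu ξ =>
    .of_anchor ha (hAdm' u hu) (hsol u hu ξ).1 le_rfl (hsol u hu ξ).2.2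
  obtain ⟨w, hw1, hw2, hw3, hw4, hw⟩ := exists_weight_pullback ha (hAdm' u0 hu0)
    (S := sol u0) (htraj u0 hu0) (fun ξ => (hsol u0 hu0 ξ).2.1) (hK0.cthickening (r := 1))
  refine ⟨w, hw1, hw2, hw3, .of_forall hw4, fun ε hε => ?_⟩
  obtain ⟨δ, hδ, hδs⟩ := exists_uniform_stability (p := fun ξ s => (sol u0 ξ s).1) hK0 hK0G0
    hstab (half_pos hε)
  refine ⟨min δ 1, lt_min hδ one_pos, fun ξ hξ u hu _ hlt hG => ⟨ε / 2, half_lt_self hε, ?_⟩⟩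
  have hpull : ∀ t ≥ (0:ℝ), sol u0 (κ t (sol u ξ t)) t = sol u ξ t := by
    intro t ht
    obtain ⟨Y, hYc, hYt, hY, hκY⟩ := hκ t ht (sol u ξ t)
    rw [hκY]
    exact (IsTrajectory.eq_of_eq_zero ha (hAdm' u0 hu0) (htraj u0 hu0 _)
      (.of_anchor ha (hAdm' u0 hu0) hYc ht hY) (hsol u0 hu0 _).2.1 ht).trans hYt
  have hz0 : κ 0 (sol u ξ 0) = ξ := by
    rw [← (hsol u0 hu0 (κ 0 (sol u ξ 0))).2.1, hpull 0 le_rfl, (hsol u hu ξ).2.1]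
  intro t ht
  have hz := hw ξ (Metric.closedBall_subset_cthickening hξ 1) u (hAdm' u hu) (sol u ξ)
    (htraj u hu ξ) (fun t => κ t (sol u ξ t)) hz0 hpull
    (fun t ht => (hlt t ht).trans_le (min_le_right _ _)) t ht
  have := hδs ξ hξ _ (hG t ht) (hz.trans_lt ((hlt t ht).trans_le (min_le_left _ _))) t ht
  simp only [hpull t ht] at this
  exact this.le
end

section
/- Let 0 ≤ τ₁ ≤ τ₂, let s : [τ₁,τ₂] → [0,∞) be integrable, let y₁ : [τ₁,τ₂] → E be absolutely continuous with ẏ₁(t) = b(t,y₁(t)) a.e., and let y₂ : [τ₁,τ₂] → E be absolutely continuous with ‖ẏ₂(t) − b(t,y₂(t))‖ ≤ s(t) a.e. and y₁(τ₁) = y₂(τ₁). Then ‖y₁(τ₂) − y₂(τ₂)‖ ≤ e^{M(τ₂) − 2M(τ₁)} ∫_{τ₁}^{τ₂} e^{M(t)} s(t) dt. -/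
open MeasureTheory Set intervalIntegral

/-- Postcomposing an absolutely continuous function with a Lipschitz function gives an absolutely
continuous function. -/
theorem AbsolutelyContinuousOnInterval.lipschitzOnWith_comp {X Y : Type*} [PseudoMetricSpace X]
    [PseudoMetricSpace Y] {f : ℝ → X} {g : X → Y} {a b : ℝ} {K : NNReal} {s : Set X}
    (hf : AbsolutelyContinuousOnInterval f a b) (hg : LipschitzOnWith K g s)
    (hs : MapsTo f (uIcc a b) s) : AbsolutelyContinuousOnInterval (g ∘ f) a b := by
  rw [absolutelyContinuousOnInterval_iff] at hf ⊢
  intro ε hε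
  obtain ⟨δ, hδ, h⟩ := hf (ε / (K + 1)) (by positivity)
  refine ⟨δ, hδ, fun I hI hlen => ?_⟩
  calc
    _ ≤ ∑ i ∈ Finset.range I.1, K * dist (f (I.2 i).1) (f (I.2 i).2) :=
      Finset.sum_le_sum fun i hi =>
        hg.dist_le_mul _ (hs (hI.1 i hi).1) _ (hs (hI.1 i hi).2)
    _ = K * ∑ i ∈ Finset.range I.1, dist (f (I.2 i).1) (f (I.2 i).2) :=
      (Finset.mul_sum _ _ _).symm
    _ ≤ K * (ε / (K + 1)) := by gcongr; exact (h I hI hlen).le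
    _ < (K + 1) * (ε / (K + 1)) := by gcongr; linarith
    _ = ε := by field

/-- The exponential of an absolutely continuous function is absolutely continuous. -/
theorem AbsolutelyContinuousOnInterval.rexp {f : ℝ → ℝ} {a b : ℝ}
    (hf : AbsolutelyContinuousOnInterval f a b) :
    AbsolutelyContinuousOnInterval (fun t => Real.exp (f t)) a b := by
  obtain ⟨C, hC⟩ := hf.exists_bound
  obtain ⟨K, hK⟩ := (Real.contDiff_exp (n := 1)).contDiffOn.exists_lipschitzOnWith
    (by decide) (convex_Icc (-C) C) isCompact_Icc
  exact hf.lipschitzOnWith_comp hK fun t ht => abs_le.1 (hC t ht)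

/-- **Grönwall's inequality** in integral form, with integrable coefficients. -/
theorem le_exp_mul_integral_of_le_integral {a b : ℝ} (hab : a ≤ b) {u L σ : ℝ → ℝ}
    (hL0 : ∀ t, 0 ≤ L t) (hL : IntervalIntegrable L volume a b)
    (hσ : IntervalIntegrable σ volume a b) (hu : ContinuousOn u (Icc a b))
    (hle : ∀ t ∈ Icc a b, u t ≤ ∫ s in a..t, (L s * u s + σ s)) :
    u b ≤ Real.exp (∫ s in a..b, L s) *
      ∫ t in a..b, Real.exp (-∫ s in a..t, L s) * σ t := by
  rw [← uIcc_of_le hab] at hu hle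
  have hf : IntervalIntegrable (fun s => L s * u s + σ s) volume a b :=
    (hL.mul_continuousOn hu).add hσ
  set w : ℝ → ℝ := fun t => ∫ s in a..t, (L s * u s + σ s)
  set Λ : ℝ → ℝ := fun t => ∫ s in a..t, L s
  have hwAC : AbsolutelyContinuousOnInterval w a b :=
    hf.absolutelyContinuousOnInterval_intervalIntegral left_mem_uIcc
  have heAC : AbsolutelyContinuousOnInterval (fun t => Real.exp (-Λ t)) a b :=
    (hL.absolutelyContinuousOnInterval_intervalIntegral left_mem_uIcc).fun_neg.rexp
  have hgAC := heAC.fun_mul hwAC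
  have hderiv : ∫ t in a..b, deriv (fun t => Real.exp (-Λ t) * w t) t ≤
      ∫ t in a..b, Real.exp (-Λ t) * σ t := by
    refine integral_mono_ae_restrict hab hgAC.intervalIntegrable_deriv
      (hσ.continuousOn_mul heAC.continuousOn) ?_
    filter_upwards [(ae_restrict_iff' measurableSet_Icc).2 (by
        simpa only [uIcc_of_le hab] using hf.ae_hasDerivAt_integral),
      (ae_restrict_iff' measurableSet_Icc).2 (by
        simpa only [uIcc_of_le hab] using hL.ae_hasDerivAt_integral),
      ae_restrict_mem measurableSet_Icc] with t hwt hΛt ht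
    have ha : a ∈ Icc a b := left_mem_Icc.2 hab
    have hd : HasDerivAt (fun t => Real.exp (-Λ t) * w t)
        (Real.exp (-Λ t) * -L t * w t + Real.exp (-Λ t) * (L t * u t + σ t)) t :=
      (hΛt a ha).neg.exp.mul (hwt a ha)
    rw [hd.deriv]
    have hmul : L t * u t ≤ L t * w t :=
      mul_le_mul_of_nonneg_left (hle t (uIcc_of_le hab ▸ ht)) (hL0 t)
    have := mul_le_mul_of_nonneg_left hmul (Real.exp_pos (-Λ t)).le
    linarith
  rw [hgAC.integral_deriv_eq_sub] at hderiv
  have hwa : w a = 0 := integral_same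
  rw [hwa, mul_zero, sub_zero] at hderiv
  calc u b ≤ w b := hle b right_mem_uIcc
    _ = Real.exp (Λ b) * (Real.exp (-Λ b) * w b) := by
      rw [← mul_assoc, ← Real.exp_add, add_neg_cancel, Real.exp_zero, one_mul]
    _ ≤ _ := by gcongr

/-- A Carathéodory function composed with a continuous curve is measurable along the curve. -/
theorem aestronglyMeasurable_comp_of_continuousOn {E : Type*} [NormedAddCommGroup E]
    [NormedSpace ℝ E] [FiniteDimensional ℝ E] [MeasurableSpace E] [BorelSpace E] {b : ℝ → E → E}
    (hbmeas : ∀ y : E, Measurable fun t => b t y) (hbcont : ∀ t : ℝ, Continuous fun y => b t y)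
    {y : ℝ → E} {s : Set ℝ} (hs : MeasurableSet s) (hy : ContinuousOn y s) :
    AEStronglyMeasurable (fun t => b t (y t)) (volume.restrict s) := by
  have : ProperSpace E := FiniteDimensional.proper_real E
  have h : Measurable (Function.uncurry fun y t => b t y) :=
    measurable_uncurry_of_continuous_of_measurable hbcont hbmeas
  exact (h.comp_aemeasurable ((hy.aemeasurable hs).prodMk aemeasurable_id)).aestronglyMeasurable

/-- **Perturbation estimate forward in time** (from the proof of Proposition
`dop`).  `E` is a finite-dimensional Euclidean space, `L` locally integrable
and nonnegative, `M t = ∫_0^t L`, `b` measurable in `t`, continuous and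
`L(t)`-Lipschitz in `y`.  If on `[τ₁,τ₂]` the function `y₁` is an exact
solution of `ẏ = b(t,y)`, `y₂` is an approximate solution with defect bounded
by `σ` and the same value at `τ₁`, then
`‖y₁ τ₂ − y₂ τ₂‖ ≤ e^{M(τ₂) − 2M(τ₁)} ∫_{τ₁}^{τ₂} e^{M(t)} σ(t) dt`. -/
theorem approximate_solution_estimate
    {E : Type*} [NormedAddCommGroup E] [InnerProductSpace ℝ E]
    [FiniteDimensional ℝ E] [MeasurableSpace E] [BorelSpace E]
    (L M : ℝ → ℝ) (hL0 : ∀ t, 0 ≤ L t)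
    (hLint : ∀ T : ℝ, IntegrableOn L (Icc 0 T))
    (hM : ∀ t : ℝ, M t = ∫ s in (0:ℝ)..t, L s)
    (b : ℝ → E → E)
    (hbmeas : ∀ y : E, Measurable fun t => b t y)
    (hbcont : ∀ t : ℝ, Continuous fun y => b t y)
    (hblip : ∀ (t : ℝ) (y₁ y₂ : E), ‖b t y₁ - b t y₂‖ ≤ L t * ‖y₁ - y₂‖)
    (hbext : ∀ t₀ ≥ (0:ℝ), ∀ y₀ : E, ∃ Y : ℝ → E, ContinuousOn Y (Ici 0) ∧
        Y t₀ = y₀ ∧ ∀ t ≥ (0:ℝ), Y t = y₀ + ∫ s in t₀..t, b s (Y s))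
    (τ₁ τ₂ : ℝ) (hτ₁ : 0 ≤ τ₁) (hτ₁₂ : τ₁ ≤ τ₂)
    (σ : ℝ → ℝ) (hσ0 : ∀ t, 0 ≤ σ t) (hσint : IntegrableOn σ (Icc τ₁ τ₂))
    (y₁ y₂ : ℝ → E)
    (hy₁c : ContinuousOn y₁ (Icc τ₁ τ₂)) (hy₂c : ContinuousOn y₂ (Icc τ₁ τ₂))
    (hy₁ : ∀ t ∈ Icc τ₁ τ₂, y₁ t = y₁ τ₁ + ∫ s in τ₁..t, b s (y₁ s))
    (y₂' : ℝ → E) (hy₂'int : IntegrableOn y₂' (Icc τ₁ τ₂))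
    (hy₂ : ∀ t ∈ Icc τ₁ τ₂, y₂ t = y₂ τ₁ + ∫ s in τ₁..t, y₂' s)
    (hdefect : ∀ᵐ t ∂(volume.restrict (Icc τ₁ τ₂)), ‖y₂' t - b t (y₂ t)‖ ≤ σ t)
    (hinit : y₁ τ₁ = y₂ τ₁) :
    ‖y₁ τ₂ - y₂ τ₂‖ ≤
      Real.exp (M τ₂ - 2 * M τ₁) * ∫ t in τ₁..τ₂, Real.exp (M t) * σ t := by
  have hLI : ∀ s t, 0 ≤ s → 0 ≤ t → IntervalIntegrable L volume s t := fun s t hs ht =>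
    intervalIntegrable_iff.2 <| (hLint (max s t)).mono_set fun x hx =>
      ⟨(le_min hs ht).trans hx.1.le, hx.2⟩
  have hMsub : ∀ t, 0 ≤ t → ∫ s in τ₁..t, L s = M t - M τ₁ := fun t ht => by
    rw [hM, hM, integral_interval_sub_left (hLI _ _ le_rfl ht) (hLI _ _ le_rfl hτ₁)]
  have hL := hLI τ₁ τ₂ hτ₁ (hτ₁.trans hτ₁₂)
  have hb₂ : IntegrableOn (fun t => b t (y₂ t)) (Icc τ₁ τ₂) := by
    refine Integrable.mono' (hy₂'int.norm.add hσint)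
      (aestronglyMeasurable_comp_of_continuousOn hbmeas hbcont measurableSet_Icc hy₂c) ?_
    filter_upwards [hdefect] with t ht
    have := norm_sub_norm_le (b t (y₂ t)) (y₂' t)
    rw [norm_sub_rev] at this
    simp only [Pi.add_apply]
    linarith
  have hu : ContinuousOn (fun t => ‖y₁ t - y₂ t‖) (Icc τ₁ τ₂) := (hy₁c.sub hy₂c).norm
  have hLu : IntegrableOn (fun t => L t * ‖y₁ t - y₂ t‖) (Icc τ₁ τ₂) :=
    ((intervalIntegrable_iff_integrableOn_Icc_of_le hτ₁₂).1 hL).mul_continuousOn hu isCompact_Icc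
  have hb₁ : IntegrableOn (fun t => b t (y₁ t)) (Icc τ₁ τ₂) := by
    refine Integrable.mono' (hb₂.norm.add hLu)
      (aestronglyMeasurable_comp_of_continuousOn hbmeas hbcont measurableSet_Icc hy₁c)
      (.of_forall fun t => ?_)
    have := norm_sub_norm_le (b t (y₁ t)) (b t (y₂ t))
    have := hblip t (y₁ t) (y₂ t)
    simp only [Pi.add_apply]
    linarith
  have hle : ∀ t ∈ Icc τ₁ τ₂,
      ‖y₁ t - y₂ t‖ ≤ ∫ s in τ₁..t, (L s * ‖y₁ s - y₂ s‖ + σ s) := by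
    intro t ht
    have hsub : Icc τ₁ t ⊆ Icc τ₁ τ₂ := Icc_subset_Icc_right ht.2
    have hii {f : ℝ → E} (hf : IntegrableOn f (Icc τ₁ τ₂)) :
        IntervalIntegrable f volume τ₁ t :=
      (intervalIntegrable_iff_integrableOn_Icc_of_le ht.1).2 (hf.mono_set hsub)
    rw [hy₁ t ht, hy₂ t ht, hinit, add_sub_add_left_eq_sub,
      ← intervalIntegral.integral_sub (hii hb₁) (hii hy₂'int)]
    refine norm_integral_le_of_norm_le ht.1 ?_
      ((intervalIntegrable_iff_integrableOn_Icc_of_le ht.1).2 ((hLu.add hσint).mono_set hsub))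
    filter_upwards [(ae_restrict_iff' measurableSet_Icc).1 hdefect] with s hs hst
    have h₁ := hblip s (y₁ s) (y₂ s)
    have h₂ := hs (hsub (Ioc_subset_Icc_self hst))
    have h₃ := norm_sub_le_norm_sub_add_norm_sub (b s (y₁ s)) (b s (y₂ s)) (y₂' s)
    rw [norm_sub_rev (b s (y₂ s))] at h₃
    linarith
  have hσI : IntervalIntegrable σ volume τ₁ τ₂ :=
    (intervalIntegrable_iff_integrableOn_Icc_of_le hτ₁₂).2 hσint
  refine (le_exp_mul_integral_of_le_integral hτ₁₂ hL0 hL hσI hu hle).trans ?_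
  have hΛ : ContinuousOn (fun t => ∫ s in τ₁..t, L s) (uIcc τ₁ τ₂) :=
    (hL.absolutelyContinuousOnInterval_intervalIntegral left_mem_uIcc).continuousOn
  have hMc : ContinuousOn M (uIcc τ₁ τ₂) :=
    (hΛ.add_const (M τ₁)).congr fun t ht => by
      rw [uIcc_of_le hτ₁₂] at ht
      simp only [hMsub t (hτ₁.trans ht.1), sub_add_cancel]
  rw [hMsub τ₂ (hτ₁.trans hτ₁₂), ← intervalIntegral.integral_const_mul,
    ← intervalIntegral.integral_const_mul]
  refine integral_mono_on hτ₁₂ ((hσI.continuousOn_mul hΛ.neg.rexp).const_mul _)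
    ((hσI.continuousOn_mul hMc.rexp).const_mul _) fun t ht => ?_
  have hMt := hMsub t (hτ₁.trans ht.1)
  have hnn : 0 ≤ ∫ s in τ₁..t, L s := integral_nonneg ht.1 fun s _ => hL0 s
  rw [← mul_assoc, ← mul_assoc, ← Real.exp_add, ← Real.exp_add]
  refine mul_le_mul_of_nonneg_right (Real.exp_le_exp.2 ?_) (hσ0 t)
  linarith
end
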